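/- arXiv:1012.2381 — 2 statements merged into one kernel-verified Lean document; each statement's English description precedes it below -/
import Mathlib

section
/- There exists a countably infinite structure Δ whose signature consists of two binary relation symbols (a digraph arc relation and a linear order symbol) such that Δ is ordered, homogeneous, and Ramsey, and both Expr_pp(Δ) and Expr_ep(Δ) are undecidable. -/
open FirstOrder FirstOrder.Language

namespace PaperDef

/-- The structure `M` is *ordered*: some binary relation symbol of the signature
denotes a linear order on the domain. -/
def Ordered (L : Language) (M : Type*) [L.Structure M] : Prop :=
  ∃ r : L.Relations 2, IsLinearOrder M (fun a b => Structure.RelMap r ![a, b])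

/-- A class of structures is a *Ramsey class*. -/
def RamseyClass {L : Language} (K : Set (CategoryTheory.Bundled.{0} L.Structure)) : Prop :=
  ∀ k : ℕ, 1 ≤ k → ∀ H ∈ K, ∀ P ∈ K, ∃ S ∈ K,
    ∀ χ : {Q : L.Substructure S // Nonempty (P ≃[L] Q)} → Fin k,
      ∃ e : H ↪[L] S,
        ∀ Q₁ Q₂ : {Q : L.Substructure S // Nonempty (P ≃[L] Q)},
          (Q₁.1 : Set S) ⊆ Set.range e → (Q₂.1 : Set S) ⊆ Set.range e → χ Q₁ = χ Q₂

/-- `M` is *finitely bounded*: membership of a finite(ly generated) structure in the age of `M`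
is characterized by finitely many forbidden substructures. -/
def FinitelyBounded (L : Language) (M : Type) [L.Structure M] : Prop :=
  ∃ (k : ℕ) (F : Fin k → CategoryTheory.Bundled.{0} L.Structure),
    (∀ i, Structure.FG L (F i)) ∧
    ∀ A : CategoryTheory.Bundled.{0} L.Structure, Structure.FG L A →
      (A ∈ L.age M ↔ ∀ i, ¬ Nonempty ((F i) ↪[L] A))

/-- The `L'`-structure on `M` is a *reduct* of the `L`-structure on `M`:
every relation of the former is first-order definable in the latter. -/
def IsReduct (L L' : Language) (M : Type*) [L.Structure M] [L'.Structure M] : Prop :=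
  ∀ (n : ℕ) (r : L'.Relations n), ∃ φ : L.Formula (Fin n),
    ∀ x : Fin n → M, Structure.RelMap r x ↔ φ.Realize x

/-- Two `n`-tuples have the same (complete first-order) type. -/
def SameType (L : Language) (M : Type*) [L.Structure M] {n : ℕ} (a b : Fin n → M) : Prop :=
  ∀ φ : L.Formula (Fin n), φ.Realize a ↔ φ.Realize b

/-- A function is *canonical*: it maps tuples of equal types to tuples of equal types. -/
def Canonical (L L' : Language) (X Ω : Type*) [L.Structure X] [L'.Structure Ω]
    (f : X → Ω) : Prop :=
  ∀ (n : ℕ) (a b : Fin n → X), SameType L X a b →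
    SameType L' Ω (fun i => f (a i)) (fun i => f (b i))

/-- A function is *canonical on a set `F`*. -/
def CanonicalOn (L L' : Language) (X Ω : Type*) [L.Structure X] [L'.Structure Ω]
    (F : Set X) (f : X → Ω) : Prop :=
  ∀ (n : ℕ) (a b : Fin n → X), (∀ i, a i ∈ F) → (∀ i, b i ∈ F) → SameType L X a b →
    SameType L' Ω (fun i => f (a i)) (fun i => f (b i))

/-- `M` is ω-categorical: every countable model of its complete theory is isomorphic to it. -/
def OmegaCategorical (L : Language) (M : Type) [L.Structure M] : Prop :=
  ∀ (N : Type) [L.Structure N], Countable N →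
    (∀ φ : L.Sentence, φ ∈ L.completeTheory M → N ⊨ φ) → Nonempty (M ≃[L] N)

/-- Primitive positive formulas: built from atomic formulas using `∧` and `∃`. -/
inductive IsPrimitivePositive {L : Language} {α : Type*} :
    ∀ {n : ℕ}, L.BoundedFormula α n → Prop
  | atomic {n : ℕ} {φ : L.BoundedFormula α n} (h : φ.IsAtomic) : IsPrimitivePositive φ
  | inf {n : ℕ} {φ ψ : L.BoundedFormula α n} :
      IsPrimitivePositive φ → IsPrimitivePositive ψ → IsPrimitivePositive (φ ⊓ ψ)
  | ex {n : ℕ} {φ : L.BoundedFormula α (n + 1)} :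
      IsPrimitivePositive φ → IsPrimitivePositive φ.ex

/-- Existential formulas: existentially quantified quantifier-free formulas. -/
inductive IsExistential {L : Language} {α : Type*} :
    ∀ {n : ℕ}, L.BoundedFormula α n → Prop
  | of_isQF {n : ℕ} {φ : L.BoundedFormula α n} (h : φ.IsQF) : IsExistential φ
  | ex {n : ℕ} {φ : L.BoundedFormula α (n + 1)} : IsExistential φ → IsExistential φ.ex

/-- Existential positive formulas: built from atomic formulas using `∧`, `∨` and `∃`. -/
inductive IsExistentialPositive {L : Language} {α : Type*} :
    ∀ {n : ℕ}, L.BoundedFormula α n → Prop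
  | atomic {n : ℕ} {φ : L.BoundedFormula α n} (h : φ.IsAtomic) : IsExistentialPositive φ
  | inf {n : ℕ} {φ ψ : L.BoundedFormula α n} :
      IsExistentialPositive φ → IsExistentialPositive ψ → IsExistentialPositive (φ ⊓ ψ)
  | sup {n : ℕ} {φ ψ : L.BoundedFormula α n} :
      IsExistentialPositive φ → IsExistentialPositive ψ → IsExistentialPositive (φ ⊔ ψ)
  | ex {n : ℕ} {φ : L.BoundedFormula α (n + 1)} :
      IsExistentialPositive φ → IsExistentialPositive φ.ex

/-- A `k`-ary operation *preserves* an `m`-ary relation. -/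
def Preserves {D : Type*} {k m : ℕ} (f : (Fin k → D) → D) (R : (Fin m → D) → Prop) : Prop :=
  ∀ rows : Fin k → Fin m → D, (∀ j, R (rows j)) → R (fun i => f (fun j => rows j i))

/-- A unary operation *preserves* an `m`-ary relation. -/
def Preserves1 {D : Type*} {m : ℕ} (f : D → D) (R : (Fin m → D) → Prop) : Prop :=
  ∀ a : Fin m → D, R a → R (fun i => f (a i))

/-- An endomorphism of the structure `M`. -/
def IsEndo (L : Language) (M : Type*) [L.Structure M] (f : M → M) : Prop :=
  ∀ (n : ℕ) (r : L.Relations n) (x : Fin n → M),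
    Structure.RelMap r x → Structure.RelMap r (fun i => f (x i))

/-- A self-embedding of the structure `M`. -/
def IsSelfEmb (L : Language) (M : Type*) [L.Structure M] (f : M → M) : Prop :=
  Function.Injective f ∧ ∀ (n : ℕ) (r : L.Relations n) (x : Fin n → M),
    (Structure.RelMap r (fun i => f (x i)) ↔ Structure.RelMap r x)

/-- A polymorphism of the structure `M`. -/
def IsPoly (L : Language) (M : Type*) [L.Structure M] {k : ℕ} (f : (Fin k → M) → M) : Prop :=
  ∀ (n : ℕ) (r : L.Relations n), Preserves f (fun x : Fin n → M => Structure.RelMap r x)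

/-- The set of endomorphisms of `M`. -/
def EndSet (L : Language) (M : Type*) [L.Structure M] : Set (M → M) :=
  {f | IsEndo L M f}

/-- Two tuples lie in the same orbit of the automorphism group. -/
def SameOrbit (L : Language) (M : Type*) [L.Structure M] {n : ℕ} (a b : Fin n → M) : Prop :=
  ∃ α : M ≃[L] M, ∀ i, α (a i) = b i

/-- The subsets `s` and `t` induce isomorphic substructures. -/
def SetIso (L : Language) (X : Type*) [L.Structure X] (s t : Set X) : Prop :=
  ∃ g : s ≃ t, ∀ (n : ℕ) (r : L.Relations n) (x : Fin n → s),
    (Structure.RelMap r (fun j => ((x j : X))) ↔ Structure.RelMap r (fun j => ((g (x j) : t) : X)))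

/-- The `L[[Fin n]]`-structure on `M` obtained by naming the constants `c 0, …, c (n-1)`. -/
def withConstantsStruct (L : Language) {M : Type*} [L.Structure M] {n : ℕ} (c : Fin n → M) :
    (L[[Fin n]]).Structure M :=
  letI := constantsOn.structure c
  inferInstance

/-- Two sequences of `n` tuples from a product `Ξ₁ × ⋯ × Ξₘ` have the same type:
componentwise, the corresponding `n`-tuples have the same type. -/
def SameSeqType {m : ℕ} (Ls : Fin m → Language) (Xs : Fin m → Type*)
    [∀ i, (Ls i).Structure (Xs i)] {n : ℕ} (a b : Fin n → ∀ i, Xs i) : Prop :=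
  ∀ i, SameType (Ls i) (Xs i) (fun j => a j i) (fun j => b j i)

/-- A function defined on a product of structures is canonical. -/
def CanonicalProd {m : ℕ} (Ls : Fin m → Language) (Xs : Fin m → Type*)
    [∀ i, (Ls i).Structure (Xs i)] (L' : Language) (Ω : Type*) [L'.Structure Ω]
    (f : (∀ i, Xs i) → Ω) : Prop :=
  ∀ (n : ℕ) (a b : Fin n → ∀ i, Xs i), SameSeqType Ls Xs a b →
    SameType L' Ω (fun j => f (a j)) (fun j => f (b j))

end PaperDef

namespace PaperDef

open Computability

/-- An `Encodable` instance for bounded formulas, via `BoundedFormula.listEncode`. -/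
instance instEncodableSigmaBoundedFormula (L : Language) (α : Type*) [Encodable α]
    [∀ i, Encodable (L.Functions i)] [∀ i, Encodable (L.Relations i)] :
    Encodable (Σ n, L.BoundedFormula α n) :=
  Encodable.ofLeftInjection (fun φ => φ.2.listEncode)
    (fun l => (BoundedFormula.listDecode l).head?)
    (fun φ => by
      have h := BoundedFormula.listDecode_encode_list (L := L) (α := α) [φ]
      rw [List.flatMap_singleton] at h
      show (BoundedFormula.listDecode φ.2.listEncode).head? = some φ
      rw [h]
      rfl)

/-- An `Encodable` instance for formulas. -/
instance instEncodableFormula (L : Language) (α : Type*) [Encodable α]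
    [∀ i, Encodable (L.Functions i)] [∀ i, Encodable (L.Relations i)] :
    Encodable (L.Formula α) :=
  Encodable.ofLeftInjection
    (fun φ => (⟨0, φ⟩ : Σ n, L.BoundedFormula α n))
    (fun q => match q with
      | ⟨0, φ⟩ => some φ
      | ⟨_ + 1, _⟩ => none)
    (fun _ => rfl)

/-- A formula together with the number of its free variables.  A (quantifier-free) formula
`φᵢ` as in the input of the problems `Expr_pp`, `Expr_ex`, `Expr_ep`. -/
abbrev FormulaCode (L : Language) : Type _ :=
  (m : ℕ) × L.Formula (Fin m)

/-- The signature with one relation symbol for each formula in the list `l`,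
of the corresponding arity. -/
def sigOf {L : Language} (l : List (FormulaCode L)) : Language :=
  ⟨fun _ => Empty, fun n => {i : Fin l.length // (l.get i).1 = n}⟩

/-- The structure `(D; R₁, …, Rₙ)` on the domain of `M` whose relations are defined by the
formulas in the list `l`. -/
def structOf {L : Language} (M : Type*) [L.Structure M] (l : List (FormulaCode L)) :
    (sigOf l).Structure M where
  funMap := fun f _ => f.elim
  RelMap := fun r x => (l.get r.1).2.Realize (fun v => x (Fin.cast r.2 v))

/-- The relation defined by `φ₀` over `M` is primitive positive definable in the structure
whose relations are defined by the formulas in `l`. -/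
def ExprYesPP {L : Language} (M : Type*) [L.Structure M]
    (φ₀ : FormulaCode L) (l : List (FormulaCode L)) : Prop :=
  letI := structOf M l
  ∃ ψ : (sigOf l).Formula (Fin φ₀.1), IsPrimitivePositive ψ ∧
    ∀ x : Fin φ₀.1 → M, φ₀.2.Realize x ↔ ψ.Realize x

/-- The relation defined by `φ₀` over `M` is existentially definable in the structure
whose relations are defined by the formulas in `l`. -/
def ExprYesEx {L : Language} (M : Type*) [L.Structure M]
    (φ₀ : FormulaCode L) (l : List (FormulaCode L)) : Prop :=
  letI := structOf M l
  ∃ ψ : (sigOf l).Formula (Fin φ₀.1), IsExistential ψ ∧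
    ∀ x : Fin φ₀.1 → M, φ₀.2.Realize x ↔ ψ.Realize x

/-- The relation defined by `φ₀` over `M` is existentially positively definable in the
structure whose relations are defined by the formulas in `l`. -/
def ExprYesEP {L : Language} (M : Type*) [L.Structure M]
    (φ₀ : FormulaCode L) (l : List (FormulaCode L)) : Prop :=
  letI := structOf M l
  ∃ ψ : (sigOf l).Formula (Fin φ₀.1), IsExistentialPositive ψ ∧
    ∀ x : Fin φ₀.1 → M, φ₀.2.Realize x ↔ ψ.Realize x

/-- Decidability of the problem `Expr_pp(Γ)`: there is a computable function on codes which,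
for every input consisting of quantifier-free formulas `φ₀` and `φ₁, …, φₙ`, decides whether
the relation defined by `φ₀` is primitive positive definable from the relations defined by
`φ₁, …, φₙ`. -/
def DecidableExprPP (L : Language) (M : Type*) [L.Structure M] [∀ i, Encodable (L.Functions i)]
    [∀ i, Encodable (L.Relations i)] : Prop :=
  ∃ f : ℕ → Bool, Computable f ∧
    ∀ (φ₀ : FormulaCode L) (l : List (FormulaCode L)),
      BoundedFormula.IsQF φ₀.2 → (∀ p ∈ l, BoundedFormula.IsQF p.2) →
      (f (Encodable.encode (φ₀, l)) = true ↔ ExprYesPP M φ₀ l)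

/-- Decidability of the problem `Expr_ex(Γ)`. -/
def DecidableExprEx (L : Language) (M : Type*) [L.Structure M] [∀ i, Encodable (L.Functions i)]
    [∀ i, Encodable (L.Relations i)] : Prop :=
  ∃ f : ℕ → Bool, Computable f ∧
    ∀ (φ₀ : FormulaCode L) (l : List (FormulaCode L)),
      BoundedFormula.IsQF φ₀.2 → (∀ p ∈ l, BoundedFormula.IsQF p.2) →
      (f (Encodable.encode (φ₀, l)) = true ↔ ExprYesEx M φ₀ l)

/-- Decidability of the problem `Expr_ep(Γ)`. -/
def DecidableExprEP (L : Language) (M : Type*) [L.Structure M] [∀ i, Encodable (L.Functions i)]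
    [∀ i, Encodable (L.Relations i)] : Prop :=
  ∃ f : ℕ → Bool, Computable f ∧
    ∀ (φ₀ : FormulaCode L) (l : List (FormulaCode L)),
      BoundedFormula.IsQF φ₀.2 → (∀ p ∈ l, BoundedFormula.IsQF p.2) →
      (f (Encodable.encode (φ₀, l)) = true ↔ ExprYesEP M φ₀ l)

end PaperDef

namespace PaperDef
/-- The signature consisting of exactly two binary relation symbols
(a digraph arc relation and a linear order symbol). -/
def DOLang : Language :=
  ⟨fun _ => Empty, fun n => if n = 2 then Fin 2 else Empty⟩

instance (n : ℕ) : IsEmpty (DOLang.Functions n) :=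
  inferInstanceAs (IsEmpty Empty)

instance (n : ℕ) : Encodable (DOLang.Functions n) :=
  inferInstanceAs (Encodable Empty)

instance (n : ℕ) : Encodable (DOLang.Relations n) := by
  show Encodable (if n = 2 then Fin 2 else Empty)
  split <;> infer_instance

end PaperDef

namespace RamseyPart
open Combinatorics

theorem finset_ramsey (k : ℕ) : ∀ p h : ℕ, ∃ N : ℕ, ∀ (col : Finset ℕ → Fin (k+1)) (X : Finset ℕ),
    N ≤ X.card → ∃ Y ⊆ X, Y.card = h ∧ ∃ c, ∀ Z ⊆ Y, Z.card = p → col Z = c := by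
  intro p
  induction p with
  | zero =>
    intro h
    refine ⟨h, fun col X hX => ?_⟩
    obtain ⟨Y, hY, hc⟩ := Finset.exists_subset_card_eq hX
    refine ⟨Y, hY, hc, col ∅, fun Z _ hZ => ?_⟩
    rw [Finset.card_eq_zero.1 hZ]
  | succ p ih =>
    intro h
    have pre : ∀ q : ℕ, ∃ N : ℕ, ∀ (col : Finset ℕ → Fin (k+1)) (X : Finset ℕ), N ≤ X.card →
        ∃ Y ⊆ X, Y.card = q ∧ ∃ κ : ℕ → Fin (k+1), ∀ y ∈ Y, ∀ Z ⊆ Y, (∀ z ∈ Z, y < z) →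
          Z.card = p → col (insert y Z) = κ y := by
      intro q
      induction q with
      | zero =>
        refine ⟨0, fun col X _ => ⟨∅, by simp, by simp, fun _ => 0, by simp⟩⟩
      | succ q ihq =>
        obtain ⟨Nq, hNq⟩ := ihq
        obtain ⟨N, hN⟩ := ih Nq
        refine ⟨N + 1, fun col X hX => ?_⟩
        have hne : X.Nonempty := Finset.card_pos.1 (by omega)
        set y := X.min' hne with hy
        have hyX : y ∈ X := Finset.min'_mem _ _
        obtain ⟨Y', hY', hY'c, c, hc⟩ := hN (fun Z => col (insert y Z)) (X.erase y)
          (by rw [Finset.card_erase_of_mem hyX]; omega)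
        obtain ⟨Y, hY, hYc, κ, hκ⟩ := hNq col Y' hY'c.ge
        have hlt : ∀ z ∈ Y, y < z := fun z hz => by
          have h1 := hY' (hY hz)
          rw [Finset.mem_erase] at h1
          exact lt_of_le_of_ne (Finset.min'_le _ _ h1.2) (Ne.symm h1.1)
        have hyY : y ∉ Y := fun h => lt_irrefl _ (hlt y h)
        refine ⟨insert y Y, ?_, by rw [Finset.card_insert_of_notMem hyY, hYc],
          Function.update κ y c, ?_⟩
        · intro z hz
          rcases Finset.mem_insert.1 hz with rfl | hz
          · exact hyX
          · exact Finset.mem_of_mem_erase (hY' (hY hz))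
        · intro w hw Z hZ hZw hZc
          rcases Finset.mem_insert.1 hw with rfl | hw
          · rw [Function.update_self]
            refine hc Z (fun z hz => ?_) hZc
            rcases Finset.mem_insert.1 (hZ hz) with h1 | h1
            · exact absurd (hZw z hz) (by rw [h1]; exact lt_irrefl _)
            · exact hY h1
          · rw [Function.update_of_ne (ne_of_gt (hlt w hw))]
            refine hκ w hw Z (fun z hz => ?_) hZw hZc
            rcases Finset.mem_insert.1 (hZ hz) with h1 | h1
            · have := hZw z hz
              have := hlt w hw
              omega
            · exact h1
    obtain ⟨N, hN⟩ := pre ((k+1) * h + 1)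
    refine ⟨N, fun col X hX => ?_⟩
    obtain ⟨Y, hY, hYc, κ, hκ⟩ := hN col X hX
    obtain ⟨c, -, hc⟩ := Finset.exists_lt_card_fiber_of_mul_lt_card_of_maps_to
      (s := Y) (t := Finset.univ) (f := κ) (n := h) (by simp) (by simp [hYc])
    obtain ⟨W, hW, hWc⟩ := Finset.exists_subset_card_eq hc.le
    refine ⟨W, fun z hz => hY (Finset.mem_filter.1 (hW hz)).1, hWc, c, fun Z hZ hZc => ?_⟩
    have hne : Z.Nonempty := Finset.card_pos.1 (by omega)
    have hm := Finset.min'_mem Z hne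
    rw [← Finset.insert_erase hm, hκ _ (Finset.mem_filter.1 (hW (hZ hm))).1]
    · exact (Finset.mem_filter.1 (hW (hZ hm))).2
    · intro z hz
      exact (Finset.mem_filter.1 (hW (hZ (Finset.mem_of_mem_erase hz)))).1
    · intro z hz
      exact lt_of_le_of_ne (Finset.min'_le _ _ (Finset.mem_of_mem_erase hz))
        (Ne.symm (Finset.ne_of_mem_erase hz))
    · rw [Finset.card_erase_of_mem hm, hZc]; rfl

theorem fun_ramsey (k p h : ℕ) : ∃ N : ℕ, ∀ col : (Fin p → ℕ) → Fin (k+1),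
    ∃ t : Fin h → ℕ, StrictMono t ∧ (∀ i, t i < N) ∧ ∀ s s' : Fin p → Fin h,
      StrictMono s → StrictMono s' → col (t ∘ s) = col (t ∘ s') := by
  obtain ⟨N, hN⟩ := finset_ramsey k p h
  refine ⟨N, fun col => ?_⟩
  obtain ⟨Y, hY, hYc, c, hc⟩ := hN
    (fun Z => if hZ : Z.card = p then col (Z.orderEmbOfFin hZ) else 0) (Finset.range N) (by simp)
  have key : ∀ s : Fin p → Fin h, StrictMono s → col (Y.orderEmbOfFin hYc ∘ s) = c := by
    intro s hs
    have hm : StrictMono (Y.orderEmbOfFin hYc ∘ s) := (Y.orderEmbOfFin hYc).strictMono.comp hs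
    have hcard : (Finset.univ.image (Y.orderEmbOfFin hYc ∘ s)).card = p := by
      rw [Finset.card_image_of_injective _ hm.injective]; simp
    have h1 := hc (Finset.univ.image (Y.orderEmbOfFin hYc ∘ s)) (by
      intro z hz
      obtain ⟨i, -, rfl⟩ := Finset.mem_image.1 hz
      exact Finset.orderEmbOfFin_mem _ _ _) hcard
    rw [dif_pos hcard] at h1
    rw [← h1]
    congr 1
    exact Finset.orderEmbOfFin_unique hcard (fun x => by simp) hm
  refine ⟨Y.orderEmbOfFin hYc, (Y.orderEmbOfFin hYc).strictMono, fun i => ?_, fun s s' hs hs' => ?_⟩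
  · exact Finset.mem_range.1 (hY (Finset.orderEmbOfFin_mem _ _ _))
  · rw [key s hs, key s' hs']

end RamseyPart

namespace RamseyPart
open Combinatorics

/-- Colours of pairs: `0` = no arc, `1` = arc going up, `2` = arc going down. -/
abbrev T := Fin 3

/-- The colours of the `m`-th forbidden clique (an ordered cycle on `m + 3` vertices). -/
def cyc (m : ℕ) (i j : Fin (m + 3)) : T :=
  if j.1 = i.1 + 1 ∨ (i.1 = 0 ∧ j.1 = m + 2) then 2 else 1

theorem cyc_ne_zero (m : ℕ) (i j : Fin (m + 3)) : cyc m i j ≠ 0 := by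
  unfold cyc; split <;> decide

/-- No forbidden clique with index in `S` occurs transversally. -/
def Free (S : Set ℕ) {V I : Type} [LinearOrder I] (π : V → I) (c : V → V → T) : Prop :=
  ∀ m ∈ S, ∀ f : Fin (m + 3) → V, StrictMono (π ∘ f) →
    ¬ ∀ i j, i < j → c (f i) (f j) = cyc m i j

structure Pic (I : Type) where
  V : Type
  fin : Finite V
  π : V → I
  c : V → V → T

variable {I : Type} [LinearOrder I]

def IsCopy (B : Pic I) {p : ℕ} (s : Fin p → I) (pc : Fin p → Fin p → T) (a : Fin p → B.V) : Prop :=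
  (∀ j, B.π (a j) = s j) ∧ ∀ j k, j < k → B.c (a j) (a k) = pc j k

def PEmb (B B' : Pic I) (g : B.V → B'.V) : Prop :=
  (∀ v, B'.π (g v) = B.π v) ∧ ∀ u v, B.π u < B.π v → B'.c (g u) (g v) = B.c u v

def Good (d : I → I → T) (B : Pic I) : Prop :=
  ∀ u v, B.π u < B.π v → B.c u v ≠ 0 → B.c u v = d (B.π u) (B.π v)

open Classical in
noncomputable def pick (R : T → Prop) : T := if h : ∃ t, R t then h.choose else 0

theorem pick_ne_zero {R : T → Prop} (h : pick R ≠ 0) : R (pick R) := by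
  unfold pick at *
  split at h
  · rename_i h1; rw [dif_pos h1]; exact h1.choose_spec
  · exact absurd rfl h

theorem pick_eq {R : T → Prop} {t : T} (h : R t) (hu : ∀ t', R t' → t' = t) : pick R = t := by
  have h1 : ∃ t, R t := ⟨t, h⟩
  unfold pick
  rw [dif_pos h1]
  exact hu _ h1.choose_spec

section Partite
variable (B : Pic I) {p : ℕ} (s : Fin p → I) (pc : Fin p → Fin p → T)

abbrev Cp := {a : Fin p → B.V // IsCopy B s pc a}

variable {B s pc} {ι : Type}

def gl (l : Line (Cp B s pc) ι) (j : Fin p) (b : B.V) (i : ι) : B.V :=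
  match l.idxFun i with
  | none => b
  | some a => a.1 j

theorem gl_none {l : Line (Cp B s pc) ι} {j : Fin p} {b : B.V} {i : ι} (h : l.idxFun i = none) :
    gl l j b i = b := by simp [gl, h]

theorem gl_some {l : Line (Cp B s pc) ι} {j : Fin p} {b : B.V} {i : ι} {a}
    (h : l.idxFun i = some a) : gl l j b i = a.1 j := by simp [gl, h]

theorem gl_pi {l : Line (Cp B s pc) ι} {j : Fin p} {b : B.V} (hb : B.π b = s j) (i : ι) :
    B.π (gl l j b i) = s j := by
  rcases h : l.idxFun i with _ | a
  · rw [gl_none h, hb]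
  · rw [gl_some h, a.2.1]

/-- The colour relation on the vertices of the new picture. -/
def PRel : ((ι → B.V) ⊕ (Line (Cp B s pc) ι × B.V)) → ((ι → B.V) ⊕ (Line (Cp B s pc) ι × B.V)) →
    T → Prop
  | .inl u, .inl w, t => ∃ j k, j < k ∧ (∀ i, B.π (u i) = s j) ∧ (∀ i, B.π (w i) = s k) ∧
      (∃ i, B.c (u i) (w i) = t) ∧ ∀ i, B.c (u i) (w i) = pc j k ∨ B.c (u i) (w i) = t
  | .inl u, .inr (l, v), t => ∃ j b, B.π b = s j ∧ u = gl l j b ∧ t = B.c b v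
  | .inr (l, v), .inl u, t => ∃ j b, B.π b = s j ∧ u = gl l j b ∧ t = B.c v b
  | .inr (l, v), .inr (l', v'), t => l = l' ∧ t = B.c v v'

theorem PRel_unique (hs : StrictMono s) (x y) (t t' : T)
    (h : PRel (B := B) (s := s) (pc := pc) (ι := ι) x y t) (h' : PRel x y t') : t = t' := by
  rcases x with u | ⟨l, v⟩ <;> rcases y with w | ⟨l', v'⟩
  · obtain ⟨j, k, -, hj, hk, ⟨i, hi⟩, hall⟩ := h
    obtain ⟨j', k', -, hj', hk', ⟨i', hi'⟩, hall'⟩ := h'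
    have e1 : j = j' := hs.injective ((hj i).symm.trans (hj' i))
    have e2 : k = k' := hs.injective ((hk i).symm.trans (hk' i))
    subst e1 e2
    rcases hall' i with h1 | h1
    · rcases hall i' with h2 | h2
      · rw [← hi, ← hi', h1, h2]
      · rw [← hi', h2]
    · rw [← hi, h1]
  · obtain ⟨j, b, -, hu, ht⟩ := h
    obtain ⟨j', b', -, hu', ht'⟩ := h'
    obtain ⟨i, hi⟩ := l'.proper
    have e : b = b' := by
      have := congrFun (hu.symm.trans hu') i
      rwa [gl_none hi, gl_none hi] at this
    rw [ht, ht', e]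
  · obtain ⟨j, b, -, hu, ht⟩ := h
    obtain ⟨j', b', -, hu', ht'⟩ := h'
    obtain ⟨i, hi⟩ := l.proper
    have e : b = b' := by
      have := congrFun (hu.symm.trans hu') i
      rwa [gl_none hi, gl_none hi] at this
    rw [ht, ht', e]
  · rw [h.2, h'.2]

end Partite

instance line_finite {α ι : Type} [Finite α] [Finite ι] : Finite (Line α ι) := by
  refine Finite.of_injective (fun l : Line α ι => l.idxFun) ?_
  rintro ⟨f, hf⟩ ⟨g, hg⟩ h
  simp only at h
  subst h; rfl

theorem partite_lemma (S : Set ℕ) (B : Pic I) {p : ℕ} (s : Fin p → I) (hs : StrictMono s)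
    (pc : Fin p → Fin p → T) (k : ℕ) :
    ∃ B' : Pic I,
      (∀ χ : (Fin p → B'.V) → Fin (k+1), ∃ g, PEmb B B' g ∧
        ∃ col, ∀ a, IsCopy B s pc a → χ (g ∘ a) = col) ∧
      (∀ d : I → I → T, (∀ i j, i < j → pc i j = d (s i) (s j)) → Good d B → Free S B.π B.c →
        Good d B' ∧ Free S B'.π B'.c) := by
  classical
  have := B.fin
  obtain ⟨ι, hι, HJ⟩ := Line.exists_mono_in_high_dimension (Cp B s pc) (Fin (k+1))
  obtain ⟨i0⟩ : Nonempty ι := by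
    obtain ⟨l, -⟩ := HJ (fun _ => 0)
    exact ⟨l.proper.choose⟩
  let V' := (ι → B.V) ⊕ (Line (Cp B s pc) ι × B.V)
  let B' : Pic I :=
    { V := V'
      fin := inferInstance
      π := Sum.elim (fun u => B.π (u i0)) (fun q => B.π q.2)
      c := fun x y => pick (PRel x y) }
  have hπl : ∀ u, B'.π (.inl u) = B.π (u i0) := fun _ => rfl
  have hπr : ∀ q, B'.π (.inr q) = B.π q.2 := fun _ => rfl
  have hc : ∀ x y t, PRel x y t → B'.c x y = t := fun x y t h =>
    pick_eq h (fun t' h' => PRel_unique hs x y t' t h' h)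
  have hc0 : ∀ x y, B'.c x y ≠ 0 → PRel x y (B'.c x y) := fun x y h => pick_ne_zero h
  refine ⟨B', fun χ => ?_, fun d hd hgood hfree => ?_⟩
  · obtain ⟨l, col, hl⟩ := HJ (fun β => χ (fun j => .inl (fun i => (β i).1 j)))
    let g : B.V → V' := fun v => if h : ∃ j, B.π v = s j then .inl (gl l h.choose v) else .inr (l, v)
    have gin : ∀ v j, B.π v = s j → g v = .inl (gl l j v) := by
      intro v j hj
      have h : ∃ j, B.π v = s j := ⟨j, hj⟩
      have e : h.choose = j := hs.injective (h.choose_spec.symm.trans hj)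
      simp only [g]
      rw [dif_pos h, e]
    have gout : ∀ v, (¬ ∃ j, B.π v = s j) → g v = .inr (l, v) := by
      intro v h
      simp only [g]
      rw [dif_neg h]
    refine ⟨g, ⟨fun v => ?_, fun u v huv => ?_⟩, col, fun a ha => ?_⟩
    · by_cases h : ∃ j, B.π v = s j
      · obtain ⟨j, hj⟩ := h
        rw [gin v j hj, hπl, gl_pi hj, hj]
      · rw [gout v h]; rfl
    · apply hc
      by_cases h : ∃ j, B.π u = s j
      · obtain ⟨j, hj⟩ := h
        rw [gin u j hj]
        by_cases h' : ∃ j, B.π v = s j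
        · obtain ⟨j', hj'⟩ := h'
          rw [gin v j' hj']
          refine ⟨j, j', ?_, gl_pi hj, gl_pi hj', ?_, ?_⟩
          · rw [hj, hj'] at huv
            exact hs.lt_iff_lt.1 huv
          · obtain ⟨i, hi⟩ := l.proper
            exact ⟨i, by rw [gl_none hi, gl_none hi]⟩
          · intro i
            rcases hi : l.idxFun i with _ | a
            · right; rw [gl_none hi, gl_none hi]
            · left; rw [gl_some hi, gl_some hi]
              refine a.2.2 _ _ ?_
              rw [hj, hj'] at huv
              exact hs.lt_iff_lt.1 huv
        · rw [gout v h']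
          exact ⟨j, u, hj, rfl, rfl⟩
      · rw [gout u h]
        by_cases h' : ∃ j, B.π v = s j
        · obtain ⟨j', hj'⟩ := h'
          rw [gin v j' hj']
          exact ⟨j', v, hj', rfl, rfl⟩
        · rw [gout v h']
          exact ⟨rfl, rfl⟩
    · rw [← hl ⟨a, ha⟩]
      congr 1
      funext j
      simp only [Function.comp]
      rw [gin (a j) j (ha.1 j)]
      congr 1
      funext i
      rcases hi : l.idxFun i with _ | a
      · rw [gl_none hi, Line.apply_none _ _ _ hi]
      · rw [gl_some hi, Line.apply_def]
        simp [hi]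
  · -- key fact for inside pairs
    have inin : ∀ u w, B'.c (.inl u) (.inl w) ≠ 0 → ∀ i, B.π (u i) = B.π (u i0) ∧
        B.π (w i) = B.π (w i0) ∧ B.c (u i) (w i) = B'.c (.inl u) (.inl w) ∧
        B.π (u i) < B.π (w i) := by
      intro u w h0 i
      obtain ⟨j, k, hjk, hj, hk, ⟨i', hi'⟩, hall⟩ := hc0 _ _ h0
      have hlt : ∀ i, B.π (u i) < B.π (w i) := fun i => by rw [hj, hk]; exact hs hjk
      have e : B'.c (.inl u) (.inl w) = pc j k := by
        rw [hd _ _ hjk, ← hj i', ← hk i', ← hi']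
        exact hgood _ _ (hlt i') (by rw [hi']; exact h0)
      refine ⟨by rw [hj, hj], by rw [hk, hk], ?_, hlt i⟩
      rcases hall i with h | h
      · rw [h, e]
      · exact h
    constructor
    · intro x y hxy h0
      rcases x with u | ⟨l, v⟩ <;> rcases y with w | ⟨l', v'⟩
      · obtain ⟨-, -, h3, h4⟩ := inin u w h0 i0
        rw [← h3]
        exact hgood _ _ h4 (by rw [h3]; exact h0)
      · obtain ⟨j, b, hb, rfl, ht⟩ := hc0 _ _ h0
        have e : B'.π (.inl (gl l' j b)) = B.π b := by rw [hπl, gl_pi hb, hb]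
        rw [e, hπr] at hxy ⊢
        rw [ht]
        exact hgood _ _ hxy (by rw [← ht]; exact h0)
      · obtain ⟨j, b, hb, rfl, ht⟩ := hc0 _ _ h0
        have e : B'.π (.inl (gl l j b)) = B.π b := by rw [hπl, gl_pi hb, hb]
        rw [e, hπr] at hxy ⊢
        rw [ht]
        exact hgood _ _ hxy (by rw [← ht]; exact h0)
      · obtain ⟨rfl, ht⟩ := hc0 _ _ h0
        rw [hπr, hπr] at hxy ⊢
        rw [ht]
        exact hgood _ _ hxy (by rw [← ht]; exact h0)
    · intro m hm f hf hcf
      have hne : ∀ i j, i < j → B'.c (f i) (f j) ≠ 0 := fun i j h => by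
        rw [hcf i j h]; exact cyc_ne_zero _ _ _
      -- the suitable coordinate
      obtain ⟨i, h1, h2⟩ : ∃ i : ι, (∀ x u, f x = .inl u → B.π (u i) = B.π (u i0)) ∧
          (∀ x l v, f x = .inr (l, v) → l.idxFun i = none) := by
        by_cases hr : ∃ x0 l0 v0, f x0 = .inr (l0, v0)
        · obtain ⟨x0, l0, v0, hx0⟩ := hr
          obtain ⟨i, hi⟩ := l0.proper
          refine ⟨i, fun x u hx => ?_, fun x l v hx => ?_⟩
          · rcases lt_trichotomy x x0 with h | h | h
            · have := hc0 _ _ (hne _ _ h)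
              rw [hx, hx0] at this
              obtain ⟨j, b, hb, rfl, -⟩ := this
              rw [gl_pi hb, gl_pi hb]
            · rw [h, hx0] at hx; cases hx
            · have := hc0 _ _ (hne _ _ h)
              rw [hx, hx0] at this
              obtain ⟨j, b, hb, rfl, -⟩ := this
              rw [gl_pi hb, gl_pi hb]
          · rcases lt_trichotomy x x0 with h | h | h
            · have := hc0 _ _ (hne _ _ h)
              rw [hx, hx0] at this
              obtain ⟨rfl, -⟩ := this
              exact hi
            · rw [h, hx0] at hx; cases hx; exact hi
            · have := hc0 _ _ (hne _ _ h)
              rw [hx, hx0] at this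
              obtain ⟨rfl, -⟩ := this
              exact hi
        · refine ⟨i0, fun x u hx => rfl, fun x l v hx => absurd ⟨x, l, v, hx⟩ hr⟩
      let pr : V' → B.V := Sum.elim (fun u => u i) (fun q => q.2)
      have hpr : ∀ x, B.π (pr (f x)) = B'.π (f x) := by
        intro x
        rcases hx : f x with u | ⟨l, v⟩
        · exact h1 x u hx
        · rfl
      refine hfree m hm (pr ∘ f) ?_ ?_
      · intro x y hxy
        simp only [Function.comp]
        rw [hpr, hpr]
        exact hf hxy
      · intro x y hxy
        rw [← hcf x y hxy]
        have h0 := hne x y hxy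
        have hP := hc0 _ _ h0
        simp only [Function.comp]
        rcases hx : f x with u | ⟨l, v⟩ <;> rcases hy : f y with w | ⟨l', v'⟩ <;>
          rw [hx, hy] at h0 hP
        · exact (inin u w h0 i).2.2.1
        · obtain ⟨j, b, hb, hu, ht⟩ := hP
          rw [ht, hu]
          change B.c (gl l' j b i) v' = _
          rw [gl_none (h2 y l' v' hy)]
        · obtain ⟨j, b, hb, hu, ht⟩ := hP
          rw [ht, hu]
          change B.c v (gl l j b i) = _
          rw [gl_none (h2 x l v hx)]
        · exact hP.2.symm

theorem partite_iter (S : Set ℕ) {p : ℕ} (pc : Fin p → Fin p → T) (k : ℕ)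
    (L : List (Fin p → I)) : (∀ s ∈ L, StrictMono s) → ∀ B : Pic I,
    ∃ B' : Pic I,
      (∀ χ : (Fin p → B'.V) → Fin (k+1), ∃ g, PEmb B B' g ∧
        ∀ s ∈ L, ∃ col, ∀ a, IsCopy B s pc a → χ (g ∘ a) = col) ∧
      (∀ d : I → I → T, (∀ s ∈ L, ∀ i j, i < j → pc i j = d (s i) (s j)) → Good d B →
        Free S B.π B.c → Good d B' ∧ Free S B'.π B'.c) := by
  induction L with
  | nil =>
    intro _ B
    refine ⟨B, fun χ => ⟨id, ⟨fun _ => rfl, fun _ _ _ => rfl⟩, by simp⟩, fun d _ h1 h2 => ⟨h1, h2⟩⟩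
  | cons s L ih =>
    intro hL B
    obtain ⟨B1, h1, h1'⟩ := partite_lemma S B s (hL s (by simp)) pc k
    obtain ⟨B2, h2, h2'⟩ := ih (fun s hs => hL s (by simp [hs])) B1
    refine ⟨B2, fun χ => ?_, fun d hd hg hf => ?_⟩
    · obtain ⟨g2, hg2, hcol2⟩ := h2 χ
      obtain ⟨g1, hg1, hcol1⟩ := h1 (fun a => χ (g2 ∘ a))
      refine ⟨g2 ∘ g1, ⟨fun v => ?_, fun u v huv => ?_⟩, fun s' hs' => ?_⟩
      · rw [Function.comp, hg2.1, hg1.1]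
      · rw [Function.comp, Function.comp, hg2.2 _ _ (by rwa [hg1.1, hg1.1]), hg1.2 _ _ huv]
      · rcases List.mem_cons.1 hs' with rfl | hs'
        · exact hcol1
        · obtain ⟨col, hcol⟩ := hcol2 s' hs'
          refine ⟨col, fun a ha => hcol (g1 ∘ a) ⟨fun j => ?_, fun j k hjk => ?_⟩⟩
          · rw [Function.comp, hg1.1, ha.1]
          · rw [Function.comp, Function.comp, hg1.2, ha.2 _ _ hjk]
            rw [ha.1, ha.1]
            exact hL s' (by simp [hs']) hjk
    · obtain ⟨a1, a2⟩ := h1' d (hd s (by simp)) hg hf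
      exact h2' d (fun s hs => hd s (by simp [hs])) a1 a2

/-- `s` is a copy of `P` in `H`. -/
def CopyIn {p h : ℕ} (pc : Fin p → Fin p → T) (hc : Fin h → Fin h → T) (s : Fin p → Fin h) : Prop :=
  StrictMono s ∧ ∀ i j, i < j → hc (s i) (s j) = pc i j

open Classical in
theorem construction (S : Set ℕ) {p h : ℕ} (pc : Fin p → Fin p → T) (hc : Fin h → Fin h → T)
    (k : ℕ) (TT : Set (Fin h → I)) (hfin : TT.Finite) (hmono : ∀ t ∈ TT, StrictMono t)
    (RB : ∀ col : (Fin p → I) → Fin (k+1), ∃ t ∈ TT, ∀ s s', CopyIn pc hc s → CopyIn pc hc s' →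
      col (t ∘ s) = col (t ∘ s')) :
    ∃ B : Pic I, (∀ χ : (Fin p → B.V) → Fin (k+1), ∃ e : Fin h → B.V, StrictMono (B.π ∘ e) ∧
        (∀ i j, i < j → B.c (e i) (e j) = hc i j) ∧
        ∀ s s', CopyIn pc hc s → CopyIn pc hc s' → χ (e ∘ s) = χ (e ∘ s')) ∧
      ∀ d : I → I → T, (∀ t ∈ TT, ∀ i j, i < j → d (t i) (t j) = hc i j) →
        Free S (id : Fin h → Fin h) hc → Free S B.π B.c := by
  have := hfin.to_subtype
  let B0 : Pic I :=
    { V := TT × Fin h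
      fin := inferInstance
      π := fun q => q.1.1 q.2
      c := fun q r => if q.1 = r.1 then hc q.2 r.2 else 0 }
  have hLfin : {s : Fin p → I | ∃ t ∈ TT, ∃ s', CopyIn pc hc s' ∧ s = t ∘ s'}.Finite := by
    refine ((hfin.prod (Set.finite_univ (α := Fin p → Fin h))).image
      (fun q => q.1 ∘ q.2)).subset ?_
    rintro s ⟨t, ht, s', -, rfl⟩
    exact ⟨(t, s'), ⟨ht, trivial⟩, rfl⟩
  have hL : ∀ s, s ∈ hLfin.toFinset.toList ↔ ∃ t ∈ TT, ∃ s', CopyIn pc hc s' ∧ s = t ∘ s' := by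
    intro s; simp
  obtain ⟨B, hB, hB'⟩ := partite_iter S pc k hLfin.toFinset.toList (by
    intro s hs
    obtain ⟨t, ht, s', hs', rfl⟩ := (hL s).1 hs
    exact (hmono t ht).comp hs'.1) B0
  refine ⟨B, fun χ => ?_, fun d hd hfree => ?_⟩
  · obtain ⟨g, hg, hcol⟩ := hB χ
    choose! col hcol using hcol
    obtain ⟨t, ht, hts⟩ := RB col
    refine ⟨fun x => g (⟨t, ht⟩, x), ?_, ?_, ?_⟩
    · intro x y hxy
      simp only [Function.comp, hg.1]
      exact hmono t ht hxy
    · intro x y hxy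
      rw [hg.2]
      · simp [B0]
      · exact hmono t ht hxy
    · have key : ∀ s, CopyIn pc hc s → χ ((fun x => g (⟨t, ht⟩, x)) ∘ s) = col (t ∘ s) := by
        intro s hs
        refine hcol (t ∘ s) ((hL _).2 ⟨t, ht, s, hs, rfl⟩) (fun j => (⟨t, ht⟩, s j)) ⟨?_, ?_⟩
        · intro j; rfl
        · intro i j hij
          simp [B0, hs.2 i j hij]
      intro s s' hs hs'
      rw [key s hs, key s' hs', hts s s' hs hs']
  · refine (hB' d ?_ ?_ ?_).2
    · intro s hs i j hij
      obtain ⟨t, ht, s', hs', rfl⟩ := (hL s).1 hs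
      rw [← hs'.2 i j hij]
      exact (hd t ht _ _ (hs'.1 hij)).symm
    · rintro ⟨⟨t, ht⟩, x⟩ ⟨⟨t', ht'⟩, y⟩ hlt h0
      simp only [B0] at hlt h0 ⊢
      split_ifs at h0 ⊢ with he
      · obtain rfl : t = t' := congrArg Subtype.val he
        exact (hd t ht x y ((hmono t ht).lt_iff_lt.1 hlt)).symm
      · exact absurd rfl h0
    · intro m hm f hf hcf
      have hsame : ∀ x, (f x).1 = (f 0).1 := by
        intro x
        by_contra hne
        have h0 : (0 : Fin (m+3)) < x := by
          rw [Fin.pos_iff_ne_zero]; rintro rfl; exact hne rfl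
        have := hcf 0 x h0
        simp only [B0] at this
        rw [if_neg (fun h => hne h.symm)] at this
        exact cyc_ne_zero _ _ _ this.symm
      refine hfree m hm (fun x => (f x).2) ?_ ?_
      · intro x y hxy
        have := hf hxy
        simp only [Function.comp, B0] at this
        rw [hsame x, hsame y] at this
        exact (hmono _ (f 0).1.2).lt_iff_lt.1 this
      · intro x y hxy
        rw [← hcf x y hxy]
        simp [B0, hsame x, hsame y]

theorem sort_pic (S : Set ℕ) (B : Pic I) : ∃ (N : ℕ) (c : Fin N → Fin N → T) (σ : Fin N ≃ B.V),
    (∀ x y, B.π (σ x) < B.π (σ y) → x < y ∧ c x y = B.c (σ x) (σ y)) ∧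
    (Free S B.π B.c → Free S (id : Fin N → Fin N) c) := by
  classical
  have := B.fin
  obtain ⟨N, ⟨e⟩⟩ := Finite.exists_equiv_fin B.V
  let τ := Tuple.sort (B.π ∘ e.symm)
  have hτ : Monotone ((B.π ∘ e.symm) ∘ τ) := Tuple.monotone_sort _
  let σ : Fin N ≃ B.V := τ.trans e.symm
  refine ⟨N, fun x y => if B.π (σ x) < B.π (σ y) then B.c (σ x) (σ y) else 0, σ, ?_, ?_⟩
  · intro x y h
    refine ⟨?_, if_pos h⟩
    by_contra hxy
    exact absurd (hτ (not_lt.1 hxy)) (not_le.2 h)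
  · intro hf m hm f hmono hcf
    have key : ∀ x y, x < y → B.π (σ (f x)) < B.π (σ (f y)) := by
      intro x y hxy
      by_contra h
      have := hcf x y hxy
      beta_reduce at this
      rw [if_neg h] at this
      exact cyc_ne_zero _ _ _ this.symm
    refine hf m hm (σ ∘ f) (fun x y hxy => key x y hxy) (fun x y hxy => ?_)
    rw [← hcf x y hxy]
    exact (if_pos (key x y hxy)).symm

/-- Ramsey statement for coloured linear orders. -/
def RamseyFor {p h N : ℕ} (pc : Fin p → Fin p → T) (hc : Fin h → Fin h → T) (k : ℕ)
    (d : Fin N → Fin N → T) : Prop :=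
  ∀ χ : (Fin p → Fin N) → Fin (k+1), ∃ e : Fin h → Fin N, StrictMono e ∧
    (∀ i j, i < j → d (e i) (e j) = hc i j) ∧
    ∀ s s', CopyIn pc hc s → CopyIn pc hc s' → χ (e ∘ s) = χ (e ∘ s')

theorem construction_fin (S : Set ℕ) {p h : ℕ} (pc : Fin p → Fin p → T) (hc : Fin h → Fin h → T)
    (k : ℕ) (TT : Set (Fin h → I)) (hfin : TT.Finite) (hmono : ∀ t ∈ TT, StrictMono t)
    (RB : ∀ col : (Fin p → I) → Fin (k+1), ∃ t ∈ TT, ∀ s s', CopyIn pc hc s → CopyIn pc hc s' →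
      col (t ∘ s) = col (t ∘ s')) :
    ∃ (N : ℕ) (c : Fin N → Fin N → T), RamseyFor pc hc k c ∧
      ∀ d : I → I → T, (∀ t ∈ TT, ∀ i j, i < j → d (t i) (t j) = hc i j) →
        Free S (id : Fin h → Fin h) hc → Free S (id : Fin N → Fin N) c := by
  obtain ⟨B, h1, h2⟩ := construction S pc hc k TT hfin hmono RB
  obtain ⟨N, c, σ, hσ, hf⟩ := sort_pic S B
  refine ⟨N, c, fun χ => ?_, fun d hd hfr => hf (h2 d hd hfr)⟩
  obtain ⟨e, he, hce, hχ⟩ := h1 (fun a => χ (σ.symm ∘ a))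
  refine ⟨σ.symm ∘ e, fun x y hxy => (hσ _ _ ?_).1, fun x y hxy => ?_, hχ⟩
  · simpa using he hxy
  · rw [(hσ _ _ _).2, ← hce x y hxy]
    · simp
    · simpa using he hxy

theorem ramsey_free (S : Set ℕ) {p h : ℕ} (pc : Fin p → Fin p → T) (hc : Fin h → Fin h → T)
    (k : ℕ) (hfree : Free S (id : Fin h → Fin h) hc) :
    ∃ (N : ℕ) (c : Fin N → Fin N → T), RamseyFor pc hc k c ∧ Free S (id : Fin N → Fin N) c := by
  obtain ⟨N0, hN0⟩ := fun_ramsey k p h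
  obtain ⟨N, d, hd, -⟩ := construction_fin (I := ℕ) S pc hc k {t | StrictMono t ∧ ∀ i, t i < N0}
    ((Set.Finite.pi' (fun _ : Fin h => Set.finite_lt_nat N0)).subset (fun t ht i => ht.2 i))
    (fun t ht => ht.1) (fun col => by
      obtain ⟨t, h1, h2, h3⟩ := hN0 col
      exact ⟨t, ⟨h1, h2⟩, fun s s' hs hs' => h3 s s' hs.1 hs'.1⟩)
  obtain ⟨N', c, h1, h2⟩ := construction_fin (I := Fin N) S pc hc k
    {t | StrictMono t ∧ ∀ i j, i < j → d (t i) (t j) = hc i j} (Set.toFinite _)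
    (fun t ht => ht.1) (fun col => by
      obtain ⟨t, h1, h2, h3⟩ := hd col
      exact ⟨t, ⟨h1, h2⟩, h3⟩)
  exact ⟨N', c, h1, h2 d (fun t ht => ht.2) hfree⟩

end RamseyPart

namespace RamseyPart

/-- Finite conditions approximating the generic structure. -/
structure Cond (S : Set ℕ) where
  B : Finset ℚ
  c : ℚ → ℚ → T
  free : Free S (id : ℚ → ℚ) c
  supp : ∀ x y, c x y ≠ 0 → x ∈ B ∧ y ∈ B

instance condPreorder (S : Set ℕ) : Preorder (Cond S) where
  le q r := q.B ⊆ r.B ∧ ∀ x ∈ q.B, ∀ y ∈ q.B, r.c x y = q.c x y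
  le_refl q := ⟨subset_rfl, fun _ _ _ _ => rfl⟩
  le_trans q r s h1 h2 := ⟨h1.1.trans h2.1, fun x hx y hy => by
    rw [h2.2 x (h1.1 hx) y (h1.1 hy), h1.2 x hx y hy]⟩

/-- `G` is an embedding of the part `Q` of the coloured order `e`. -/
def Pres {N : ℕ} (c : ℚ → ℚ → T) (e : Fin N → Fin N → T) (G : Fin N → ℚ) (Q : Fin N → Prop) : Prop :=
  ∀ i j, i < j → Q i → Q j → G i < G j ∧ c (G i) (G j) = e i j

abbrev Task := Σ N : ℕ, (Fin N → Fin N → T) × Fin N × (Fin N → ℚ)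

def Meets (S : Set ℕ) (t : Task) (q : Cond S) : Prop :=
  (∀ i, t.2.2.2 i ∈ q.B) ∧ (Free S (id : Fin t.1 → Fin t.1) t.2.1 →
    Pres q.c t.2.1 t.2.2.2 (fun i => i ≠ t.2.2.1) →
    ∃ x ∈ q.B, Pres q.c t.2.1 (Function.update t.2.2.2 t.2.2.1 x) (fun _ => True))

theorem exists_between_avoid (lo hi B : Finset ℚ) (h : ∀ x ∈ lo, ∀ y ∈ hi, x < y) :
    ∃ x, x ∉ B ∧ (∀ y ∈ lo, y < x) ∧ ∀ y ∈ hi, x < y := by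
  classical
  obtain ⟨x0, h1, h2⟩ := Order.exists_between_finsets lo hi h
  obtain ⟨x, h3, h4⟩ := Order.exists_between_finsets (lo ∪ B.filter (· ≤ x0))
    (hi ∪ B.filter (x0 < ·)) (by
      intro x hx y hy
      simp only [Finset.mem_union, Finset.mem_filter] at hx hy
      rcases hx with hx | ⟨-, hx⟩ <;> rcases hy with hy | ⟨-, hy⟩
      · exact h x hx y hy
      · exact (h1 x hx).trans hy
      · exact hx.trans_lt (h2 y hy)
      · exact hx.trans_lt hy)
  refine ⟨x, fun hx => ?_, fun y hy => h3 y (by simp [hy]), fun y hy => h4 y (by simp [hy])⟩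
  rcases le_or_gt x x0 with h | h
  · exact lt_irrefl _ (h3 x (by simp [hx, h]))
  · exact lt_irrefl _ (h4 x (by simp [hx, h]))

theorem meets_cofinal (S : Set ℕ) (t : Task) (q : Cond S) : ∃ r, Meets S t r ∧ q ≤ r := by
  classical
  obtain ⟨N, e, m, g⟩ := t
  let B1 := q.B ∪ Finset.univ.image g
  have hgB : ∀ i, g i ∈ B1 := fun i => by simp [B1]
  have hqB : q.B ⊆ B1 := Finset.subset_union_left
  by_cases hyp : Free S (id : Fin N → Fin N) e ∧ Pres q.c e g (fun i => i ≠ m)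
  swap
  · refine ⟨⟨B1, q.c, q.free, fun x y h => ⟨hqB (q.supp x y h).1, hqB (q.supp x y h).2⟩⟩,
      ⟨hgB, fun h1 h2 => absurd ⟨h1, h2⟩ hyp⟩, ⟨hqB, fun _ _ _ _ => rfl⟩⟩
  obtain ⟨hfe, hpres⟩ := hyp
  obtain ⟨x, hxB, hlo, hhi⟩ := exists_between_avoid ((Finset.univ.filter (· < m)).image g)
    ((Finset.univ.filter (m < ·)).image g) B1 (by
      intro y hy z hz
      obtain ⟨i, hi, rfl⟩ := Finset.mem_image.1 hy
      obtain ⟨j, hj, rfl⟩ := Finset.mem_image.1 hz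
      simp only [Finset.mem_filter, Finset.mem_univ, true_and] at hi hj
      exact (hpres i j (hi.trans hj) hi.ne hj.ne').1)
  let G := Function.update g m x
  have Gm : G m = x := Function.update_self ..
  have Gne : ∀ i, i ≠ m → G i = g i := fun i hi => Function.update_of_ne hi ..
  have GB : ∀ i, i ≠ m → G i ∈ B1 := fun i hi => by rw [Gne i hi]; exact hgB i
  have Gmono : StrictMono G := by
    intro i j hij
    by_cases hi : i = m
    · subst hi
      rw [Gm, Gne j hij.ne']
      exact hhi _ (Finset.mem_image_of_mem _ (by simpa using hij))
    · by_cases hj : j = m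
      · subst hj
        rw [Gm, Gne i hi]
        exact hlo _ (Finset.mem_image_of_mem _ (by simpa using hij))
      · rw [Gne i hi, Gne j hj]
        exact (hpres i j hij hi hj).1
  have old : ∀ i j, i < j → G i ∈ B1 → G j ∈ B1 → q.c (G i) (G j) = e i j := by
    intro i j hij hi hj
    have h1 : i ≠ m := by rintro rfl; rw [Gm] at hi; exact hxB hi
    have h2 : j ≠ m := by rintro rfl; rw [Gm] at hj; exact hxB hj
    rw [Gne i h1, Gne j h2]
    exact (hpres i j hij h1 h2).2
  let c2 : ℚ → ℚ → T := fun y z => if q.c y z ≠ 0 then q.c y z else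
    pick (fun t => ∃ i j, i < j ∧ G i = y ∧ G j = z ∧ t = e i j)
  have c2pos : ∀ y z, q.c y z ≠ 0 → c2 y z = q.c y z := fun y z h => if_pos h
  have c2neg : ∀ y z, q.c y z = 0 →
      c2 y z = pick (fun t => ∃ i j, i < j ∧ G i = y ∧ G j = z ∧ t = e i j) :=
    fun y z h => if_neg (not_not.2 h)
  have c2G : ∀ i j, i < j → c2 (G i) (G j) = e i j := by
    intro i j hij
    by_cases h : q.c (G i) (G j) = 0
    · rw [c2neg _ _ h]
      refine pick_eq ⟨i, j, hij, rfl, rfl, rfl⟩ ?_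
      rintro t' ⟨i', j', -, h1, h2, rfl⟩
      rw [Gmono.injective h1, Gmono.injective h2]
    · rw [c2pos _ _ h]
      exact old i j hij (hqB (q.supp _ _ h).1) (hqB (q.supp _ _ h).2)
  have c2ne : ∀ y z, c2 y z ≠ 0 → q.c y z ≠ 0 ∨ ∃ i j, i < j ∧ G i = y ∧ G j = z := by
    intro y z h
    by_cases h0 : q.c y z = 0
    · right
      rw [c2neg _ _ h0] at h
      obtain ⟨i, j, hij, h1, h2, -⟩ := pick_ne_zero h
      exact ⟨i, j, hij, h1, h2⟩
    · exact Or.inl h0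
  have GBx : ∀ i, G i ≠ x → G i ∈ B1 := fun i hi => GB i (by rintro rfl; exact hi Gm)
  have c2old : ∀ y z, y ≠ x → z ≠ x → c2 y z = q.c y z := by
    intro y z hy hz
    by_cases h0 : q.c y z = 0
    · by_contra hne
      rw [h0] at hne
      rw [c2neg _ _ h0] at hne
      obtain ⟨i, j, hij, rfl, rfl, h3⟩ := pick_ne_zero hne
      rw [h3, ← old i j hij (GBx i hy) (GBx j hz)] at hne
      exact hne h0
    · exact c2pos _ _ h0
  have xnz : ∀ y, q.c x y = 0 ∧ q.c y x = 0 := by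
    intro y
    constructor
    · by_contra h; exact hxB (hqB (q.supp _ _ h).1)
    · by_contra h; exact hxB (hqB (q.supp _ _ h).2)
  refine ⟨⟨insert x B1, c2, ?_, ?_⟩, ⟨?_, ?_⟩, ?_, ?_⟩
  · intro k hk f hf hcf
    have hne : ∀ a b, a < b → c2 (f a) (f b) ≠ 0 := fun a b hab => by
      rw [hcf a b hab]; exact cyc_ne_zero _ _ _
    by_cases hx : ∃ a, f a = x
    · obtain ⟨a0, ha0⟩ := hx
      have hr : ∀ a, ∃ i, G i = f a := by
        intro a
        rcases lt_trichotomy a a0 with h | h | h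
        · rcases c2ne _ _ (hne _ _ h) with h1 | ⟨i, j, -, h1, -⟩
          · rw [ha0] at h1
            exact absurd (xnz _).2 h1
          · exact ⟨i, h1⟩
        · exact ⟨m, by rw [h, ha0, Gm]⟩
        · rcases c2ne _ _ (hne _ _ h) with h1 | ⟨i, j, -, -, h1⟩
          · rw [ha0] at h1
            exact absurd (xnz _).1 h1
          · exact ⟨j, h1⟩
      choose f' hf' using hr
      have hmono : StrictMono f' := by
        intro a b hab
        rw [← Gmono.lt_iff_lt, hf', hf']
        exact hf hab
      refine hfe k hk f' hmono (fun a b hab => ?_)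
      rw [← hcf a b hab, ← hf', ← hf', c2G _ _ (hmono hab)]
    · refine q.free k hk f hf (fun a b hab => ?_)
      rw [← hcf a b hab, c2old]
      · exact fun h => hx ⟨a, h⟩
      · exact fun h => hx ⟨b, h⟩
  · have hG : ∀ i, G i ∈ insert x B1 := fun i => by
      by_cases h : G i = x
      · rw [h]; exact Finset.mem_insert_self _ _
      · exact Finset.mem_insert_of_mem (GBx i h)
    intro y z h
    rcases c2ne y z h with h | ⟨i, j, -, rfl, rfl⟩
    · exact ⟨Finset.mem_insert_of_mem (hqB (q.supp _ _ h).1),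
        Finset.mem_insert_of_mem (hqB (q.supp _ _ h).2)⟩
    · exact ⟨hG i, hG j⟩
  · exact fun i => Finset.mem_insert_of_mem (hgB i)
  · intro _ _
    exact ⟨x, Finset.mem_insert_self _ _, fun i j hij _ _ => ⟨Gmono hij, c2G i j hij⟩⟩
  · exact hqB.trans (Finset.subset_insert _ _)
  · intro y hy z hz
    refine c2old y z ?_ ?_
    · rintro rfl; exact hxB (hqB hy)
    · rintro rfl; exact hxB (hqB hz)

theorem generic (S : Set ℕ) : ∃ c : ℚ → ℚ → T, Free S (id : ℚ → ℚ) c ∧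
    ∀ (N : ℕ) (e : Fin N → Fin N → T) (m : Fin N) (g : Fin N → ℚ), Free S (id : Fin N → Fin N) e →
      Pres c e g (fun i => i ≠ m) → ∃ x, Pres c e (Function.update g m x) (fun _ => True) := by
  classical
  haveI : Encodable Task := Encodable.ofCountable _
  let q0 : Cond S := ⟨∅, fun _ _ => 0, fun m _ f _ h =>
    cyc_ne_zero m 0 1 (h 0 1 (by simp [Fin.lt_def])).symm, fun x y h => absurd rfl h⟩
  let D : Task → Order.Cofinal (Cond S) := fun t => ⟨{r | Meets S t r}, fun q => meets_cofinal S t q⟩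
  let Q : ℕ → Cond S := Order.sequenceOfCofinals q0 D
  have hQ : Monotone Q := Order.sequenceOfCofinals.monotone q0 D
  have hM : ∀ t : Task, ∃ n, Meets S t (Q n) := fun t =>
    ⟨_, Order.sequenceOfCofinals.encode_mem q0 D t⟩
  have hall : ∀ x : ℚ, ∃ n, x ∈ (Q n).B := by
    intro x
    obtain ⟨n, hn⟩ := hM ⟨1, fun _ _ => 0, 0, fun _ => x⟩
    exact ⟨n, hn.1 0⟩
  choose lev hlev using hall
  have hmem : ∀ x n, lev x ≤ n → x ∈ (Q n).B := fun x n h => (hQ h).1 (hlev x)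
  let c : ℚ → ℚ → T := fun x y => (Q (max (lev x) (lev y))).c x y
  have hc : ∀ n x y, x ∈ (Q n).B → y ∈ (Q n).B → c x y = (Q n).c x y := by
    intro n x y hx hy
    rcases le_total n (max (lev x) (lev y)) with h | h
    · exact (hQ h).2 x hx y hy
    · exact ((hQ h).2 x (hmem _ _ (le_max_left _ _)) y (hmem _ _ (le_max_right _ _))).symm
  refine ⟨c, ?_, ?_⟩
  · intro m hm f hf hcf
    let n := Finset.univ.sup (fun i => lev (f i))
    have hn : ∀ i, f i ∈ (Q n).B := fun i =>
      hmem _ _ (Finset.le_sup (f := fun i => lev (f i)) (Finset.mem_univ i))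
    refine (Q n).free m hm f hf (fun i j hij => ?_)
    rw [← hc n _ _ (hn i) (hn j), hcf i j hij]
  · intro N e m g he hp
    obtain ⟨n, hn1, hn2⟩ := hM ⟨N, e, m, g⟩
    obtain ⟨x, hx, h⟩ := hn2 he (fun i j hij hi hj => by
      rw [← hc n _ _ (hn1 i) (hn1 j)]
      exact hp i j hij hi hj)
    have hu : ∀ i, Function.update g m x i ∈ (Q n).B := by
      intro i
      by_cases hi : i = m
      · subst hi; rw [Function.update_self]; exact hx
      · rw [Function.update_of_ne hi]; exact hn1 i
    refine ⟨x, fun i j hij _ _ => ?_⟩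
    rw [hc n _ _ (hu i) (hu j)]
    exact h i j hij trivial trivial

end RamseyPart

namespace RamseyPart
open PaperDef

def arcR : DOLang.Relations 2 := (0 : Fin 2)
def ordR : DOLang.Relations 2 := (1 : Fin 2)

theorem rel_cases (r : DOLang.Relations 2) : r = arcR ∨ r = ordR := by
  change Fin 2 at r
  fin_cases r
  · exact Or.inl rfl
  · exact Or.inr rfl

theorem rel_empty (n : ℕ) (h : n ≠ 2) : IsEmpty (DOLang.Relations n) := by
  refine ⟨fun r => ?_⟩
  have : DOLang.Relations n = Empty := if_neg h
  exact (cast this r : Empty).elim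

def arc {V : Type} [LinearOrder V] (c : V → V → T) (x y : V) : Prop :=
  (x < y ∧ c x y = 1) ∨ (y < x ∧ c y x = 2)

def relM2 {V : Type} [LinearOrder V] (c : V → V → T) (r : Fin 2) (x y : V) : Prop :=
  (r = 0 → arc c x y) ∧ (r = 1 → x ≤ y)

def relM {V : Type} [LinearOrder V] (c : V → V → T) :
    ∀ n : ℕ, DOLang.Relations n → (Fin n → V) → Prop
  | 2, r, x => relM2 c r (x 0) (x 1)
  | _, _, _ => False

/-- The ordered digraph on `V` given by a colouring `c`. -/
def Str (V : Type) [LinearOrder V] (_c : V → V → T) : Type := V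

instance {V : Type} [LinearOrder V] (c : V → V → T) : LinearOrder (Str V c) :=
  inferInstanceAs (LinearOrder V)

instance {V : Type} [LinearOrder V] (c : V → V → T) : DOLang.Structure (Str V c) where
  funMap := fun f _ => (f : Empty).elim
  RelMap := fun {n} r x => relM (V := V) c n r x

theorem str_arc {V : Type} [LinearOrder V] (c : V → V → T) (x : Fin 2 → Str V c) :
    Structure.RelMap arcR x ↔ arc (V := V) c (x 0) (x 1) := by
  change relM2 (V := V) c 0 (x 0) (x 1) ↔ _
  simp [relM2]

theorem str_ord {V : Type} [LinearOrder V] (c : V → V → T) (x : Fin 2 → Str V c) :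
    Structure.RelMap ordR x ↔ x 0 ≤ x 1 := by
  change relM2 (V := V) c 1 (x 0) (x 1) ↔ _
  simp only [relM2, one_ne_zero, IsEmpty.forall_iff, true_and, forall_const]
  rfl

def Pr {V W A : Type} [LinearOrder V] [LinearOrder W] (c : V → V → T) (d : W → W → T)
    (p : A → V) (F : A → W) : Prop :=
  ∀ a b, p a < p b → F a < F b ∧ d (F a) (F b) = c (p a) (p b)

theorem Pr.lt_iff {V W A : Type} [LinearOrder V] [LinearOrder W] {c : V → V → T} {d : W → W → T}
    {p : A → V} {F : A → W} (hp : Function.Injective p) (h : Pr c d p F) (a b : A) :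
    F a < F b ↔ p a < p b := by
  constructor
  · intro hab
    rcases lt_trichotomy (p a) (p b) with h1 | h1 | h1
    · exact h1
    · rw [hp h1] at hab; exact absurd hab (lt_irrefl _)
    · exact absurd hab (h _ _ h1).1.asymm
  · exact fun hab => (h a b hab).1

theorem Pr.arc_iff {V W A : Type} [LinearOrder V] [LinearOrder W] {c : V → V → T} {d : W → W → T}
    {p : A → V} {F : A → W} (hp : Function.Injective p) (h : Pr c d p F) (a b : A) :
    arc d (F a) (F b) ↔ arc c (p a) (p b) := by
  unfold arc
  rw [h.lt_iff hp, h.lt_iff hp]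
  constructor
  · rintro (⟨h1, h2⟩ | ⟨h1, h2⟩)
    · exact Or.inl ⟨h1, by rw [← (h _ _ h1).2, h2]⟩
    · exact Or.inr ⟨h1, by rw [← (h _ _ h1).2, h2]⟩
  · rintro (⟨h1, h2⟩ | ⟨h1, h2⟩)
    · exact Or.inl ⟨h1, by rw [(h _ _ h1).2, h2]⟩
    · exact Or.inr ⟨h1, by rw [(h _ _ h1).2, h2]⟩

/-- Build an embedding from an order and colour preserving map. -/
theorem mkEmb {V W A : Type} [LinearOrder V] [LinearOrder W] {c : V → V → T} {d : W → W → T}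
    [DOLang.Structure A] (p : A ↪[DOLang] Str V c) (F : A → W)
    (h : Pr c d (fun a => (p a : V)) F) :
    ∃ f : A ↪[DOLang] Str W d, ∀ a, f a = F a := by
  have hp : Function.Injective (fun a => (p a : V)) := p.injective
  refine ⟨⟨⟨F, ?_⟩, fun f => (f : Empty).elim, ?_⟩, fun a => rfl⟩
  · intro a b hab
    rcases lt_trichotomy (p a : V) (p b : V) with h1 | h1 | h1
    · exact absurd hab (h _ _ h1).1.ne
    · exact hp h1
    · exact absurd hab (h _ _ h1).1.ne'
  · intro n r x
    by_cases hn : n = 2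
    · subst hn
      rw [← p.map_rel r x]
      rcases rel_cases r with rfl | rfl
      · rw [str_arc, str_arc]
        exact h.arc_iff hp _ _
      · rw [str_ord, str_ord]
        rw [← not_lt, ← not_lt]
        exact not_congr (h.lt_iff hp _ _)
    · exact (rel_empty n hn).elim r

theorem emb_pr' {V W A : Type} [LinearOrder V] [LinearOrder W] {c : V → V → T} {d : W → W → T}
    [DOLang.Structure A] (p : A ↪[DOLang] Str V c) (f : A ↪[DOLang] Str W d) :
    Pr c d (fun a => (p a : V)) (fun a => (f a : W)) := by
  let P : A → V := fun a => p a
  let F : A → W := fun a => f a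
  have hle : ∀ a b : A, F a ≤ F b ↔ P a ≤ P b := by
    intro a b
    have h1 := f.map_rel ordR ![a, b]
    have h2 := p.map_rel ordR ![a, b]
    rw [str_ord] at h1 h2
    exact h1.trans h2.symm
  have hlt : ∀ a b : A, F a < F b ↔ P a < P b := by
    intro a b
    rw [← not_le, ← not_le, hle]
  have harc : ∀ a b : A, arc d (F a) (F b) ↔ arc c (P a) (P b) := by
    intro a b
    have h1 := f.map_rel arcR ![a, b]
    have h2 := p.map_rel arcR ![a, b]
    rw [str_arc] at h1 h2
    exact h1.trans h2.symm
  intro a b hab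
  replace hab : P a < P b := hab
  have hab' := (hlt a b).2 hab
  refine ⟨hab', ?_⟩
  have h1 := harc a b
  have h2 := harc b a
  simp only [arc, hab, hab', hab.asymm, hab'.asymm, true_and, false_and, or_false, false_or] at h1 h2
  have key : ∀ s t : T, (s = 1 ↔ t = 1) → (s = 2 ↔ t = 2) → s = t := by decide
  exact key _ _ h1 h2

theorem emb_pr {V W : Type} [LinearOrder V] [LinearOrder W] {c : V → V → T} {d : W → W → T}
    (f : Str V c ↪[DOLang] Str W d) : Pr (A := V) c d (fun a => a) (fun a => (f a : W)) :=
  emb_pr' (Embedding.refl DOLang (Str V c)) f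

theorem strEmb {V W : Type} [LinearOrder V] [LinearOrder W] {c : V → V → T} {d : W → W → T}
    (F : V → W) (h : ∀ a b, a < b → F a < F b ∧ d (F a) (F b) = c a b) :
    ∃ f : Str V c ↪[DOLang] Str W d, ∀ a : V, f a = F a :=
  mkEmb (Embedding.refl DOLang (Str V c)) F h

def IsGen (S : Set ℕ) (c : ℚ → ℚ → T) : Prop := Free S (id : ℚ → ℚ) c ∧
    ∀ (N : ℕ) (e : Fin N → Fin N → T) (m : Fin N) (g : Fin N → ℚ), Free S (id : Fin N → Fin N) e →
      Pres c e g (fun i => i ≠ m) → ∃ x, Pres c e (Function.update g m x) (fun _ => True)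

theorem Free.pull {S : Set ℕ} {V W : Type} [LinearOrder V] [LinearOrder W] {c : V → V → T}
    {d : W → W → T} (hd : Free S (id : W → W) d) (F : V → W)
    (h : ∀ a b, a < b → F a < F b ∧ d (F a) (F b) = c a b) : Free S (id : V → V) c := by
  intro m hm f hf hc
  refine hd m hm (F ∘ f) (fun i j hij => (h _ _ (hf hij)).1) (fun i j hij => ?_)
  rw [← hc i j hij]
  exact (h _ _ (hf hij)).2

theorem embed_fin {S : Set ℕ} {c : ℚ → ℚ → T} (hg : IsGen S c) :
    ∀ (n : ℕ) (e : Fin n → Fin n → T), Free S (id : Fin n → Fin n) e →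
      ∃ g : Fin n → ℚ, Pres c e g (fun _ => True) := by
  intro n
  induction n with
  | zero => exact fun e _ => ⟨fun _ => 0, fun i => i.elim0⟩
  | succ n ih =>
    intro e he
    obtain ⟨g0, h0⟩ := ih (fun i j => e i.castSucc j.castSucc)
      (he.pull Fin.castSucc (fun a b hab => ⟨by simpa using hab, rfl⟩))
    obtain ⟨x, hx⟩ := hg.2 (n + 1) e (Fin.last n) (Fin.snoc g0 (0 : ℚ)) he (by
      intro i j hij hi hj
      obtain ⟨i, rfl⟩ := Fin.exists_castSucc_eq.2 hi
      obtain ⟨j, rfl⟩ := Fin.exists_castSucc_eq.2 hj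
      have := h0 i j (by simpa using hij) trivial trivial
      simpa using this)
    exact ⟨_, hx⟩

theorem mem_age {S : Set ℕ} {c : ℚ → ℚ → T} (hg : IsGen S c) {n : ℕ} (e : Fin n → Fin n → T)
    (he : Free S (id : Fin n → Fin n) e) :
    (⟨Str (Fin n) e, inferInstance⟩ : CategoryTheory.Bundled.{0} DOLang.Structure) ∈ DOLang.age (Str ℚ c) := by
  obtain ⟨g, h⟩ := embed_fin hg n e he
  obtain ⟨f, -⟩ := strEmb (c := e) (d := c) g (fun a b hab => h a b hab trivial trivial)
  have : Finite (Str (Fin n) e) := inferInstanceAs (Finite (Fin n))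
  exact ⟨Structure.FG.of_finite, ⟨f⟩⟩

theorem age_rep {S : Set ℕ} {c : ℚ → ℚ → T} (hg : IsGen S c)
    (A : CategoryTheory.Bundled.{0} DOLang.Structure) (hA : A ∈ DOLang.age (Str ℚ c)) :
    ∃ (n : ℕ) (e : Fin n → Fin n → T), Free S (id : Fin n → Fin n) e ∧
      Nonempty (A ≃[DOLang] Str (Fin n) e) := by
  classical
  obtain ⟨hfg, ⟨p⟩⟩ := hA
  have hfin : Finite A := hfg.finite
  have := Fintype.ofFinite A
  let X : Finset ℚ := Finset.univ.image (fun a : A => (p a : ℚ))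
  let ι := X.orderEmbOfFin rfl
  let e : Fin X.card → Fin X.card → T := fun i j => c (ι i) (ι j)
  have hr : ∀ a : A, ∃ i, ι i = p a := by
    intro a
    have : (p a : ℚ) ∈ Set.range ι := by
      rw [Finset.range_orderEmbOfFin]
      exact Finset.mem_coe.2 (Finset.mem_image_of_mem _ (Finset.mem_univ a))
    exact this
  choose F hF using hr
  obtain ⟨f, hf⟩ := mkEmb (d := e) p F (by
    intro a b hab
    refine ⟨?_, ?_⟩
    · rw [← ι.lt_iff_lt, hF, hF]; exact hab
    · simp only [e, hF])
  refine ⟨X.card, e, hg.1.pull ι (fun a b hab => ⟨ι.strictMono hab, rfl⟩), ⟨?_⟩⟩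
  refine ⟨Equiv.ofBijective f ⟨f.injective, ?_⟩, fun {n} => f.map_fun', fun {n} => f.map_rel'⟩
  intro i
  have : ι i ∈ X := Finset.orderEmbOfFin_mem ..
  obtain ⟨a, -, ha⟩ := Finset.mem_image.1 this
  refine ⟨a, ?_⟩
  rw [hf]
  apply ι.injective
  rw [hF, ha]

theorem ultrahomog {S : Set ℕ} {c : ℚ → ℚ → T} (hg : IsGen S c) :
    DOLang.IsUltrahomogeneous (Str ℚ c) := by
  classical
  have hct : Countable (Str ℚ c) := inferInstanceAs (Countable ℚ)
  rw [isUltrahomogeneous_iff_IsExtensionPair Structure.cg_of_countable,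
    isExtensionPair_iff_exists_embedding_closure_singleton_sup]
  intro A hA f m
  by_cases hm : m ∈ A
  · have hle : (Substructure.closure DOLang {m} ⊔ A : DOLang.Substructure (Str ℚ c)) ≤ A := by
      simp [hm]
    exact ⟨f.comp (Substructure.inclusion hle), by ext; rfl⟩
  have hfin : Finite A := hA.finite
  let As : Set ℚ := (A : Set (Str ℚ c))
  have hAf : As.Finite := hfin
  let X : Finset ℚ := insert m hAf.toFinset
  have hX : ∀ y : Str ℚ c, y ∈ (Substructure.closure DOLang {m} ⊔ A : DOLang.Substructure (Str ℚ c)) →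
      (y : ℚ) ∈ X := by
    intro y hy
    have h2 : (Substructure.closure DOLang {m} ⊔ A : DOLang.Substructure (Str ℚ c)) =
        Substructure.closure DOLang ({m} ∪ (A : Set (Str ℚ c))) := by
      rw [Substructure.closure_union, Substructure.closure_eq]
    rw [h2, Substructure.mem_closure_iff_of_isRelational] at hy
    rcases hy with hy | hy
    · exact Finset.mem_insert.2 (Or.inl hy)
    · exact Finset.mem_insert.2 (Or.inr (hAf.mem_toFinset.2 hy))
  let ι := X.orderEmbOfFin rfl
  have hr : ∀ y ∈ X, ∃ i, ι i = y := by
    intro y hy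
    have : y ∈ Set.range ι := by
      rw [Finset.range_orderEmbOfFin]
      exact hy
    exact this
  have hιX : ∀ i, ι i ≠ m → (ι i : ℚ) ∈ As := by
    intro i hi
    have : ι i ∈ X := Finset.orderEmbOfFin_mem ..
    rcases Finset.mem_insert.1 this with h | h
    · exact absurd h hi
    · exact hAf.mem_toFinset.1 h
  obtain ⟨m0, hm0⟩ := hr m (Finset.mem_insert_self _ _)
  obtain ⟨G0, hG0⟩ : ∃ G0 : ℚ → ℚ, ∀ a : A, G0 a.1 = f a := by
    refine ⟨fun y => if h : y ∈ As then f ⟨y, h⟩ else (0 : ℚ), fun a => ?_⟩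
    exact dif_pos (c := (a.1 : ℚ) ∈ As) a.2
  let e : Fin X.card → Fin X.card → T := fun i j => c (ι i) (ι j)
  have fpr : ∀ a b : A, (a.1 : ℚ) < b.1 → (f a : ℚ) < f b ∧ c (f a) (f b) = c a.1 b.1 :=
    emb_pr' (Substructure.subtype A) f
  have fpr2 : ∀ a b : ℚ, a ∈ As → b ∈ As → a < b → G0 a < G0 b ∧ c (G0 a) (G0 b) = c a b := by
    intro a b ha hb hab
    have h := fpr ⟨a, ha⟩ ⟨b, hb⟩ hab
    rw [← hG0, ← hG0] at h
    exact h
  obtain ⟨x, hx⟩ := hg.2 _ e m0 (fun i => G0 (ι i))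
    (hg.1.pull ι (fun a b hab => ⟨ι.strictMono hab, rfl⟩)) (by
    intro i j hij hi hj
    have h1 := hιX i (fun h => hi (ι.injective (h.trans hm0.symm)))
    have h2 := hιX j (fun h => hj (ι.injective (h.trans hm0.symm)))
    exact fpr2 _ _ h1 h2 (ι.strictMono hij))
  let G : ℚ → ℚ := Function.update G0 (ι m0) x
  have hG : ∀ i, G (ι i) = Function.update (fun i => G0 (ι i)) m0 x i := by
    intro i
    by_cases hi : i = m0
    · subst hi
      simp only [G]
      rw [Function.update_self, Function.update_self]
    · simp only [G]
      rw [Function.update_of_ne hi, Function.update_of_ne (fun h => hi (ι.injective h))]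
  obtain ⟨F, hF⟩ := mkEmb (d := c)
    (Substructure.subtype (Substructure.closure DOLang {m} ⊔ A : DOLang.Substructure (Str ℚ c)))
    (fun y => G y.1) (by
      rintro ⟨a, ha⟩ ⟨b, hb⟩ hab
      obtain ⟨i, rfl⟩ := hr a (hX a ha)
      obtain ⟨j, rfl⟩ := hr b (hX b hb)
      have hij : i < j := ι.lt_iff_lt.1 hab
      have := hx i j hij trivial trivial
      rw [← hG, ← hG] at this
      exact this)
  refine ⟨F, ?_⟩
  ext a
  rw [Embedding.comp_apply, hF]
  rw [← hG0]
  refine (Function.update_of_ne (fun h => hm ?_) x G0).symm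
  rw [← h.trans hm0]
  exact a.2

end RamseyPart

namespace RamseyPart
open PaperDef

theorem copy_fact {p h N : ℕ} {pc : Fin p → Fin p → T} {hc : Fin h → Fin h → T}
    {c : Fin N → Fin N → T} {e : Fin h → Fin N} (he : StrictMono e)
    (hec : ∀ i j, i < j → c (e i) (e j) = hc i j)
    (P : Type) [DOLang.Structure P] (uP : P ≃[DOLang] Str (Fin p) pc)
    (Q : DOLang.Substructure (Str (Fin N) c)) (hQ : Nonempty (P ≃[DOLang] Q))
    (hsub : ∀ y : Fin N, (y : Str (Fin N) c) ∈ Q → ∃ i, e i = y) :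
    ∃ s, CopyIn pc hc s ∧ ∀ y : Fin N, (y : Str (Fin N) c) ∈ Q ↔ ∃ i, e (s i) = y := by
  obtain ⟨u⟩ := hQ
  let w : Str (Fin p) pc ≃[DOLang] Q := u.comp uP.symm
  let v : Str (Fin p) pc ↪[DOLang] Str (Fin N) c := Q.subtype.comp w.toEmbedding
  have hv : ∀ i : Fin p, (v i : Str (Fin N) c) ∈ Q := fun i => (w i).2
  have hr : ∀ i : Fin p, ∃ j, e j = v i := fun i => hsub _ (hv i)
  choose s hs using hr
  have hpr : ∀ a b : Fin p, a < b → e (s a) < e (s b) ∧ c (e (s a)) (e (s b)) = pc a b := by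
    intro a b hab
    rw [hs, hs]
    exact emb_pr v a b hab
  have hmono : StrictMono s := fun a b hab => he.lt_iff_lt.1 (hpr a b hab).1
  refine ⟨s, ⟨hmono, fun i j hij => ?_⟩, fun y => ⟨fun hy => ?_, ?_⟩⟩
  · rw [← hec _ _ (hmono hij), (hpr i j hij).2]
  · refine ⟨w.symm ⟨y, hy⟩, ?_⟩
    exact (hs _).trans (congrArg Subtype.val (w.apply_symm_apply ⟨y, hy⟩))
  · rintro ⟨i, rfl⟩
    rw [hs]
    exact hv i

theorem ramsey_age {S : Set ℕ} {c : ℚ → ℚ → T} (hg : IsGen S c) :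
    RamseyClass (DOLang.age (Str ℚ c)) := by
  classical
  intro k hk H hH P hP
  obtain ⟨k, rfl⟩ : ∃ k', k = k' + 1 := ⟨k - 1, by omega⟩
  obtain ⟨h, hc, hfree, ⟨uH⟩⟩ := age_rep hg H hH
  obtain ⟨p, pc, -, ⟨uP⟩⟩ := age_rep hg P hP
  obtain ⟨N, d, hR, hd⟩ := ramsey_free S pc hc k hfree
  refine ⟨⟨Str (Fin N) d, inferInstance⟩, mem_age hg d hd, fun χ => ?_⟩
  change {Q : DOLang.Substructure (Str (Fin N) d) // Nonempty (P ≃[DOLang] Q)} → Fin (k + 1) at χ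
  let Rep (a : Fin p → Fin N)
      (Q : {Q : DOLang.Substructure (Str (Fin N) d) // Nonempty (P ≃[DOLang] Q)}) : Prop :=
    ∀ y : Fin N, (y : Str (Fin N) d) ∈ Q.1 ↔ ∃ i, a i = y
  obtain ⟨e, he, hec, hmon⟩ := hR
    (fun a => if hx : ∃ Q, Rep a Q then χ hx.choose else 0)
  have hχ : ∀ a Q, Rep a Q → (if hx : ∃ Q, Rep a Q then χ hx.choose else 0) = χ Q := by
    intro a Q hQ
    have hx : ∃ Q, Rep a Q := ⟨Q, hQ⟩
    rw [dif_pos hx]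
    congr 1
    apply Subtype.ext
    apply SetLike.ext
    intro y
    exact (hx.choose_spec y).trans (hQ y).symm
  obtain ⟨f, hf⟩ := strEmb (c := hc) (d := d) e (fun a b hab => ⟨he hab, hec a b hab⟩)
  refine ⟨f.comp uH.toEmbedding, ?_⟩
  have key : ∀ Q : {Q : DOLang.Substructure (Str (Fin N) d) // Nonempty (P ≃[DOLang] Q)},
      (Q.1 : Set (Str (Fin N) d)) ⊆ Set.range (f.comp uH.toEmbedding) →
      ∃ s, CopyIn pc hc s ∧ Rep (e ∘ s) Q := by
    intro Q hQ
    refine copy_fact he hec P uP Q.1 Q.2 (fun y hy => ?_)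
    obtain ⟨a, ha⟩ := hQ hy
    exact ⟨uH a, (hf _).symm.trans ha⟩
  intro Q₁ Q₂ h1 h2
  obtain ⟨s1, hs1, hr1⟩ := key Q₁ h1
  obtain ⟨s2, hs2, hr2⟩ := key Q₂ h2
  have := hmon s1 s2 hs1 hs2
  rw [hχ _ _ hr1, hχ _ _ hr2] at this
  exact this

theorem cyc_antichain {m m' : ℕ} (f : Fin (m' + 3) → Fin (m + 3)) (hf : StrictMono f)
    (h : ∀ i j, i < j → cyc m (f i) (f j) = cyc m' i j) : m' = m := by
  have key : ∀ i j : Fin (m' + 3), i < j →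
      (((f j).1 = (f i).1 + 1 ∨ ((f i).1 = 0 ∧ (f j).1 = m + 2)) ↔
        (j.1 = i.1 + 1 ∨ (i.1 = 0 ∧ j.1 = m' + 2))) := by
    intro i j hij
    have := h i j hij
    unfold cyc at this
    split_ifs at this with h1 h2 h2
    · exact iff_of_true h1 h2
    · exact absurd this (by decide)
    · exact absurd this (by decide)
    · exact iff_of_false h1 h2
  have mono : ∀ i j : Fin (m' + 3), i < j → (f i).1 < (f j).1 := fun i j hij => hf hij
  -- the first and last points map to the first and last points
  have h0 := (key 0 (Fin.last _) (by simp [Fin.lt_def])).2 (Or.inr ⟨rfl, rfl⟩)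
  have h01 := mono 0 1 (by simp [Fin.lt_def])
  have h1l := mono 1 (Fin.last _) (by simp [Fin.lt_def])
  have hends : (f 0).1 = 0 ∧ (f (Fin.last _)).1 = m + 2 := by omega
  have hstep : ∀ n (hn : n < m' + 3), (f ⟨n, hn⟩).1 = n := by
    intro n
    induction n with
    | zero => exact fun _ => hends.1
    | succ n ih =>
      intro hn
      have h1 := (key ⟨n, by omega⟩ ⟨n + 1, hn⟩ (by simp [Fin.lt_def])).2 (Or.inl rfl)
      have h2 := ih (by omega)
      rcases h1 with h1 | ⟨h1, h3⟩
      · omega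
      · rw [h2] at h1
        subst h1
        exfalso
        have h4 := mono ⟨1, hn⟩ (Fin.last _) (by simp [Fin.lt_def])
        simp only [Nat.zero_add] at h3
        omega
  have := hstep (m' + 2) (by omega)
  have h5 : (f ⟨m' + 2, by omega⟩).1 = m + 2 := hends.2
  omega

theorem cyc_free {S : Set ℕ} {m : ℕ} (hm : m ∉ S) :
    Free S (id : Fin (m + 3) → Fin (m + 3)) (cyc m) := by
  intro m' hm' f hf h
  have := cyc_antichain f hf h
  exact hm (this ▸ hm')

end RamseyPart

namespace RamseyPart
open PaperDef

def atomF (m : ℕ) (i j : Fin (m + 3)) : DOLang.Formula (Fin (m + 3)) :=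
  if i < j then
    (∼(Relations.formula₂ ordR (Term.var j) (Term.var i))) ⊓
    (if cyc m i j = 1 then Relations.formula₂ arcR (Term.var i) (Term.var j)
      else Relations.formula₂ arcR (Term.var j) (Term.var i))
  else ⊤

def phi (m : ℕ) : DOLang.Formula (Fin (m + 3)) :=
  ((List.finRange (m + 3)).map (fun i =>
    ((List.finRange (m + 3)).map (fun j => atomF m i j)).foldr (· ⊓ ·) ⊤)).foldr (· ⊓ ·) ⊤

theorem isQF_foldr {L : Language} {α : Type} (l : List (L.Formula α))
    (h : ∀ φ ∈ l, BoundedFormula.IsQF φ) : BoundedFormula.IsQF (l.foldr (· ⊓ ·) ⊤) := by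
  induction l with
  | nil => exact BoundedFormula.IsQF.top
  | cons a l ih =>
    exact (h a (by simp)).inf (ih (fun φ hφ => h φ (by simp [hφ])))

theorem atomF_qf (m : ℕ) (i j : Fin (m + 3)) : BoundedFormula.IsQF (atomF m i j) := by
  have h : ∀ (r : DOLang.Relations 2) (a b : DOLang.Term (Fin (m + 3))),
      BoundedFormula.IsQF (Relations.formula₂ r a b) := fun r a b =>
    (BoundedFormula.IsAtomic.rel _ _).isQF
  unfold atomF
  split_ifs
  · exact (h _ _ _).not.inf (h _ _ _)
  · exact (h _ _ _).not.inf (h _ _ _)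
  · exact BoundedFormula.IsQF.top

theorem phi_qf (m : ℕ) : BoundedFormula.IsQF (phi m) := by
  apply isQF_foldr
  intro φ hφ
  obtain ⟨i, -, rfl⟩ := List.mem_map.1 hφ
  apply isQF_foldr
  intro φ hφ
  obtain ⟨j, -, rfl⟩ := List.mem_map.1 hφ
  exact atomF_qf m i j

theorem atomF_realize {c : ℚ → ℚ → T} (m : ℕ) (x : Fin (m + 3) → Str ℚ c) (i j : Fin (m + 3)) :
    (atomF m i j).Realize x ↔ (i < j → x i < x j ∧ c (x i) (x j) = cyc m i j) := by
  unfold atomF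
  by_cases hij : i < j
  · rw [if_pos hij]
    have hcyc : cyc m i j = 1 ∨ cyc m i j = 2 := by
      unfold cyc; split <;> simp
    have hle : Structure.RelMap ordR ![x j, x i] ↔ x j ≤ x i := str_ord c ![x j, x i]
    have ha : ∀ a b, Structure.RelMap arcR ![x a, x b] ↔ arc (V := ℚ) c (x a) (x b) :=
      fun a b => str_arc c ![x a, x b]
    rw [Formula.realize_inf, Formula.realize_not, Formula.realize_rel₂]
    simp only [Term.realize_var, hij, true_imp_iff]
    rw [hle, not_le]
    refine and_congr_right (fun hlt => ?_)
    have hlt' : @LT.lt ℚ _ (x i) (x j) := hlt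
    rcases hcyc with h | h
    · rw [h, if_pos rfl, Formula.realize_rel₂]
      simp only [Term.realize_var]
      rw [ha]
      exact ⟨fun h => h.elim (·.2) (fun h => absurd hlt' h.1.asymm), fun h => Or.inl ⟨hlt', h⟩⟩
    · rw [h, if_neg (by decide), Formula.realize_rel₂]
      simp only [Term.realize_var]
      rw [ha]
      exact ⟨fun h => h.elim (fun h => absurd hlt' h.1.asymm) (·.2), fun h => Or.inr ⟨hlt', h⟩⟩
  · rw [if_neg hij]
    simp [hij]

theorem phi_realize {c : ℚ → ℚ → T} (m : ℕ) (x : Fin (m + 3) → Str ℚ c) :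
    (phi m).Realize x ↔ ∀ i j, i < j → x i < x j ∧ c (x i) (x j) = cyc m i j := by
  unfold phi Formula.Realize
  rw [BoundedFormula.realize_foldr_inf]
  simp only [List.mem_map, List.mem_finRange, true_and, forall_exists_index,
    forall_apply_eq_imp_iff]
  refine forall_congr' (fun i => ?_)
  rw [BoundedFormula.realize_foldr_inf]
  simp only [List.mem_map, List.mem_finRange, true_and, forall_exists_index,
    forall_apply_eq_imp_iff]
  exact forall_congr' (fun j => atomF_realize m x i j)

def botList : List (FormulaCode DOLang) := [⟨1, ⊥⟩]

theorem bot_rel (M : Type) [DOLang.Structure M] {n : ℕ} (r : (sigOf botList).Relations n)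
    (x : Fin n → M) : ¬ @Structure.RelMap _ _ (structOf M botList) n r x := by
  obtain ⟨⟨i, hi⟩, h⟩ := r
  have : i = 0 := by simpa [botList] using hi
  subst this
  intro h
  exact h

theorem phi_empty {S : Set ℕ} {c : ℚ → ℚ → T} (hg : IsGen S c) {m : ℕ} (hm : m ∈ S)
    (x : Fin (m + 3) → Str ℚ c) : ¬ (phi m).Realize x := by
  rw [phi_realize]
  intro h
  exact hg.1 m hm x (fun i j hij => (h i j hij).1) (fun i j hij => (h i j hij).2)

/-- The trivially false atomic formula. -/
def botF (m : ℕ) : (sigOf botList).Formula (Fin (m + 3)) :=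
  Relations.formula₁ (⟨⟨0, by simp [botList]⟩, rfl⟩ : (sigOf botList).Relations 1) (Term.var 0)

theorem botF_realize (M : Type) [DOLang.Structure M] (m : ℕ) (x : Fin (m + 3) → M) :
    ¬ @Formula.Realize _ M (structOf M botList) _ (botF m) x := by
  let := structOf M botList
  intro h
  exact bot_rel M _ _ (Formula.realize_rel₁.1 h)

theorem yes_pp {S : Set ℕ} {c : ℚ → ℚ → T} (hg : IsGen S c) {m : ℕ} (hm : m ∈ S) :
    ExprYesPP (Str ℚ c) ⟨m + 3, phi m⟩ botList :=
  ⟨botF m, .atomic (BoundedFormula.IsAtomic.rel _ _), fun x =>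
    iff_of_false (phi_empty hg hm x) (botF_realize _ m x)⟩

theorem yes_ep {S : Set ℕ} {c : ℚ → ℚ → T} (hg : IsGen S c) {m : ℕ} (hm : m ∈ S) :
    ExprYesEP (Str ℚ c) ⟨m + 3, phi m⟩ botList :=
  ⟨botF m, .atomic (BoundedFormula.IsAtomic.rel _ _), fun x =>
    iff_of_false (phi_empty hg hm x) (botF_realize _ m x)⟩

theorem not_def {S : Set ℕ} {c : ℚ → ℚ → T} (hg : IsGen S c) {m : ℕ} (hm : m ∉ S)
    (ψ : (sigOf botList).Formula (Fin (m + 3)))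
    (h : ∀ x : Fin (m + 3) → Str ℚ c, (phi m).Realize x ↔
      @Formula.Realize _ (Str ℚ c) (structOf (Str ℚ c) botList) _ ψ x) : False := by
  let := structOf (Str ℚ c) botList
  obtain ⟨g, hgp⟩ := embed_fin hg _ (cyc m) (cyc_free hm)
  let x : Fin (m + 3) → Str ℚ c := g
  have hx : (phi m).Realize x := (phi_realize m x).2 (fun i j hij => hgp i j hij trivial trivial)
  let σ : Str ℚ c ≃ Str ℚ c := Equiv.swap (x 0) (x 1)
  let τ : Str ℚ c ≃[sigOf botList] Str ℚ c :=
    ⟨σ, fun f => (f : Empty).elim, fun r y => iff_of_false (bot_rel _ _ _) (bot_rel _ _ _)⟩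
  have h1 : ψ.Realize (τ ∘ x) := (StrongHomClass.realize_formula τ ψ).2 ((h x).1 hx)
  have h2 := (phi_realize m _).1 ((h _).2 h1) 0 1 (by simp)
  have h3 := (phi_realize m _).1 hx 0 1 (by simp)
  have e0 : (τ ∘ x) 0 = x 1 := Equiv.swap_apply_left _ _
  have e1 : (τ ∘ x) 1 = x 0 := Equiv.swap_apply_right _ _
  rw [e0, e1] at h2
  exact h2.1.asymm h3.1

theorem pp_iff {S : Set ℕ} {c : ℚ → ℚ → T} (hg : IsGen S c) (m : ℕ) :
    ExprYesPP (Str ℚ c) ⟨m + 3, phi m⟩ botList ↔ m ∈ S := by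
  refine ⟨fun ⟨ψ, _, h⟩ => ?_, yes_pp hg⟩
  by_contra hm
  exact not_def hg hm ψ h

theorem ep_iff {S : Set ℕ} {c : ℚ → ℚ → T} (hg : IsGen S c) (m : ℕ) :
    ExprYesEP (Str ℚ c) ⟨m + 3, phi m⟩ botList ↔ m ∈ S := by
  refine ⟨fun ⟨ψ, _, h⟩ => ?_, yes_ep hg⟩
  by_contra hm
  exact not_def hg hm ψ h

def codeN (m : ℕ) : ℕ :=
  Encodable.encode ((⟨m + 3, phi m⟩ : FormulaCode DOLang), botList)

theorem bot_qf : ∀ p ∈ botList, BoundedFormula.IsQF p.2 := by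
  intro p hp
  simp only [botList, List.mem_singleton] at hp
  subst hp
  exact BoundedFormula.isQF_bot

theorem countable_computable : {f : ℕ → Bool | Computable f}.Countable := by
  have hex : ∀ f : {f : ℕ → Bool | Computable f}, ∃ c : Nat.Partrec.Code,
      Nat.Partrec.Code.eval c = fun n => Part.some (Encodable.encode (f.1 n)) := by
    rintro ⟨f, hf⟩
    have h1 : Computable (fun n => Encodable.encode (f n)) := Computable.encode.comp hf
    exact Nat.Partrec.Code.exists_code.1 (Partrec.nat_iff.1 h1)
  choose C hC using hex
  have hinj : Function.Injective C := by
    intro f g hfg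
    apply Subtype.ext
    funext n
    have h1 := congrFun (hC f) n
    rw [hfg, hC g] at h1
    exact (Encodable.encode_injective (Part.some_inj.1 h1)).symm
  exact Set.countable_coe_iff.1 hinj.countable

theorem exists_undecidable : ∃ S : Set ℕ, ∀ f : ℕ → Bool, Computable f →
    ¬ ∀ m, f (codeN m) = true ↔ m ∈ S := by
  by_contra hcon
  push Not at hcon
  have hc : (Set.univ : Set (Set ℕ)).Countable :=
    (countable_computable.image (fun f => {m | f (codeN m) = true})).mono (by
      intro S _
      obtain ⟨f, hf, h⟩ := hcon S
      exact ⟨f, hf, Set.ext h⟩)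
  have : Countable (Set ℕ) := Set.countable_univ_iff.1 hc
  obtain ⟨F, hF⟩ := exists_surjective_nat (Set ℕ)
  exact Function.cantor_surjective F hF

end RamseyPart

namespace PaperDef
open RamseyPart

/-- **Proposition of Section 2.**  There exists a countably infinite structure whose signature
consists of two binary relation symbols which is ordered, homogeneous and Ramsey, and for
which both `Expr_pp` and `Expr_ep` are undecidable. -/
theorem undecidability_of_Expr_pp_and_Expr_ep :
    ∃ (M : Type) (inst : DOLang.Structure M),
      Countable M ∧ Infinite M ∧
      (∀ n : ℕ, n ≠ 2 → IsEmpty (DOLang.Relations n)) ∧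
      Nonempty (DOLang.Relations 2 ≃ Fin 2) ∧
      (letI := inst
       Ordered DOLang M ∧ DOLang.IsUltrahomogeneous M ∧ RamseyClass (DOLang.age M) ∧
         ¬ DecidableExprPP DOLang M ∧ ¬ DecidableExprEP DOLang M) := by
  obtain ⟨S, hS⟩ := exists_undecidable
  obtain ⟨c, hg⟩ := generic S
  replace hg : IsGen S c := hg
  refine ⟨Str ℚ c, inferInstance, inferInstanceAs (Countable ℚ), inferInstanceAs (Infinite ℚ),
    rel_empty, ⟨Equiv.refl (Fin 2)⟩, ?_, ultrahomog hg, ramsey_age hg, ?_, ?_⟩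
  · have h : ∀ a b : Str ℚ c, Structure.RelMap ordR ![a, b] ↔ a ≤ b := fun a b => str_ord c ![a, b]
    exact ⟨ordR,
      { refl := fun a => (h a a).2 le_rfl
        trans := fun a b d h1 h2 => (h a d).2 (((h a b).1 h1).trans ((h b d).1 h2))
        antisymm := fun a b h1 h2 => le_antisymm ((h a b).1 h1) ((h b a).1 h2)
        total := fun a b => (le_total a b).imp (h a b).2 (h b a).2 }⟩
  · rintro ⟨f, hf, h⟩
    exact hS f hf (fun m => (h ⟨m + 3, phi m⟩ botList (phi_qf m) bot_qf).trans (pp_iff hg m))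
  · rintro ⟨f, hf, h⟩
    exact hS f hf (fun m => (h ⟨m + 3, phi m⟩ botList (phi_qf m) bot_qf).trans (ep_iff hg m))

end PaperDef
end

section
/- Let Θ be a countably infinite ω-categorical structure with countable relational signature, and let R be an m-ary relation on the domain of Θ. Then R has an existential definition in Θ if and only if every self-embedding of Θ preserves R. -/
open FirstOrder FirstOrder.Language

namespace PaperDef

section aux

set_option linter.style.haveILetI false

theorem exists_generic {P ι : Type*} [Preorder P] [Countable ι] (p : P) (D : ι → Set P)
    (hD : ∀ i x, ∃ y ∈ D i, x ≤ y) :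
    ∃ s : ℕ → P, Monotone s ∧ p = s 0 ∧ ∀ i, ∃ n, s n ∈ D i := by
  haveI := Encodable.ofCountable ι
  let D' : ι → Order.Cofinal P := fun i => ⟨D i, fun x => hD i x⟩
  exact ⟨Order.sequenceOfCofinals p D', Order.sequenceOfCofinals.monotone p D', rfl,
    fun i => ⟨_, Order.sequenceOfCofinals.encode_mem p D' i⟩⟩

variable {L : Language} {M : Type} [L.Structure M]

/-- Same complete type, arbitrary index sets. -/
def Same (L : Language) {M : Type} [L.Structure M] {α : Type} (u v : α → M) : Prop :=
  ∀ φ : L.Formula α, φ.Realize u ↔ φ.Realize v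

theorem Same.comp {α β : Type} {u v : α → M} (h : Same L u v) (g : β → α) :
    Same L (u ∘ g) (v ∘ g) := by
  intro φ
  rw [← Formula.realize_relabel, ← Formula.realize_relabel]
  exact h _

/-- The type of the tuple is isolated. -/
def Iso (L : Language) {M : Type} [L.Structure M] {α : Type} (u : α → M) : Prop :=
  ∃ θ : L.Formula α, θ.Realize u ∧ ∀ v, θ.Realize v → Same L u v

theorem Iso.comp {α β : Type} [Finite α] [Finite β] {u : α → M} (h : Iso L u) (g : β → α) :
    Iso L (u ∘ g) := by
  obtain ⟨θ, hu, hθ⟩ := h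
  have hd : (∅ : Set M).Definable L {v : α → M | θ.Realize v} :=
    Set.empty_definable_iff.2 ⟨θ, rfl⟩
  obtain ⟨θ', h'⟩ := Set.empty_definable_iff.1 (hd.image_comp g)
  refine ⟨θ', ?_, ?_⟩
  · change u ∘ g ∈ Set.ofPred θ'.Realize
    rw [← h']
    exact ⟨u, hu, rfl⟩
  · intro v hv
    change v ∈ Set.ofPred θ'.Realize at hv
    rw [← h'] at hv
    obtain ⟨w, hw, rfl⟩ := hv
    exact (hθ w hw).comp g

theorem sat [Countable L.Symbols] [Infinite M] (homega : OmegaCategorical L M)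
    {α : Type} [Countable α] (Γ : Set (L.Formula α))
    (h : ∀ F : Finset (L.Formula α), ↑F ⊆ Γ → ∃ v : α → M, ∀ φ ∈ F, φ.Realize v) :
    ∃ v : α → M, ∀ φ ∈ Γ, φ.Realize v := by
  classical
  let T : L[[α]].Theory := (L.lhomWithConstants α).onTheory (L.completeTheory M) ∪
    Formula.equivSentence '' Γ
  have hT : T.IsSatisfiable := by
    rw [Theory.isSatisfiable_iff_isFinitelySatisfiable]
    intro T0 hT0
    obtain ⟨v, hv⟩ := h ((T0.image Formula.equivSentence.symm).filter (· ∈ Γ)) (by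
      intro x hx
      exact (Finset.mem_filter.1 hx).2)
    letI := constantsOn.structure v
    have : M ⊨ (T0 : L[[α]].Theory) := by
      constructor
      intro φ hφ
      rcases hT0 hφ with h1 | ⟨ψ, hψ, rfl⟩
      · have : M ⊨ (L.lhomWithConstants α).onTheory (L.completeTheory M) :=
          (LHom.onTheory_model _ _).2 inferInstance
        exact this.realize_of_mem _ h1
      · rw [Formula.realize_equivSentence]
        refine hv ψ (Finset.mem_filter.2 ⟨?_, hψ⟩)
        exact Finset.mem_image.2 ⟨_, hφ, by simp⟩
    exact Theory.Model.isSatisfiable M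
  obtain ⟨N0⟩ := hT
  letI := (L.lhomWithConstants α).reduct N0
  have hN0 : N0 ⊨ L.completeTheory M := by
    rw [← LHom.onTheory_model (L.lhomWithConstants α)]
    exact Theory.Model.mono N0.is_model Set.subset_union_left
  haveI : Infinite N0 := by
    have : M ≅[L] N0 := (elementarilyEquivalent_iff ).2 fun φ => by
      constructor
      · intro hφ
        exact hN0.realize_of_mem _ ((mem_completeTheory).2 hφ)
      · intro hφ
        by_contra hn
        have := hN0.realize_of_mem (φ.not) ((mem_completeTheory).2 (by simpa using hn))
        simp at this
        exact this hφ
    exact this.infinite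
  obtain ⟨N, hN, hNc⟩ := exists_elementarilyEquivalent_card_eq (L[[α]]) N0
    (Cardinal.aleph0.{0}) le_rfl (by
      rw [Cardinal.lift_aleph0, Cardinal.lift_le_aleph0]
      exact Cardinal.mk_le_aleph0)
  have hNT : N ⊨ T := hN.theory_model_iff.1 N0.is_model
  letI := (L.lhomWithConstants α).reduct N
  haveI : Countable N := Cardinal.mk_le_aleph0_iff.1 hNc.le
  have hN1 : N ⊨ L.completeTheory M := by
    rw [← LHom.onTheory_model (L.lhomWithConstants α)]
    exact Theory.Model.mono hNT Set.subset_union_left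
  obtain ⟨e⟩ := homega N inferInstance (fun φ hφ => hN1.realize_of_mem _ hφ)
  refine ⟨fun a => e.symm (L.con a : N), fun φ hφ => ?_⟩
  have := hNT.realize_of_mem _ (Or.inr ⟨φ, hφ, rfl⟩)
  rw [Formula.realize_equivSentence] at this
  exact (StrongHomClass.realize_formula e.symm φ).2 this

theorem exists_iso [Countable L.Symbols] [Infinite M] [Countable M] (homega : OmegaCategorical L M)
    {α : Type} [Finite α] (φ : L.Formula α) (hφ : ∃ v : α → M, φ.Realize v) :
    ∃ v : α → M, φ.Realize v ∧ Iso L v := by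
  classical
  by_contra hcon
  push Not at hcon
  let P := {ψ : L.Formula α // (∃ v : α → M, ψ.Realize v) ∧
    ∀ v : α → M, ψ.Realize v → φ.Realize v}
  letI : Preorder P := Preorder.lift (fun ψ => OrderDual.toDual {v : α → M | ψ.1.Realize v})
  have hle : ∀ ψ χ : P, ψ ≤ χ ↔ ∀ v : α → M, χ.1.Realize v → ψ.1.Realize v := fun _ _ => Iff.rfl
  obtain ⟨s, hs, -, hs'⟩ := exists_generic (P := P) ⟨φ, hφ, fun _ h => h⟩
    (fun a : α → M => {ψ | ¬ ψ.1.Realize a}) (by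
      rintro a ⟨ψ, ⟨v, hv⟩, hψ⟩
      have h1 : ∃ w, ψ.Realize w ∧ ¬ Same L v w := by
        by_contra h2
        push Not at h2
        exact hcon v (hψ v hv) ⟨ψ, hv, h2⟩
      obtain ⟨w, hw, hvw⟩ := h1
      have h2 : ∃ χ : L.Formula α, χ.Realize v ∧ ¬ χ.Realize w := by
        by_contra h3
        push Not at h3
        refine hvw fun χ => ⟨h3 χ, fun h4 => ?_⟩
        by_contra h5
        exact (Formula.realize_not.1 (h3 χ.not (Formula.realize_not.2 h5))) h4
      obtain ⟨χ, h3, h4⟩ := h2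
      by_cases h5 : χ.Realize a
      · refine ⟨⟨ψ ⊓ χ.not, ⟨w, ?_⟩, ?_⟩, ?_, ?_⟩
        · simp [hw, h4]
        · intro v hv
          simp at hv
          exact hψ v hv.1
        · simp [h5]
        · rw [hle]
          intro v hv
          simp at hv
          exact hv.1
      · refine ⟨⟨ψ ⊓ χ, ⟨v, ?_⟩, ?_⟩, ?_, ?_⟩
        · simp [hv, h3]
        · intro v hv
          simp at hv
          exact hψ v hv.1
        · simp [h5]
        · rw [hle]
          intro v hv
          simp at hv
          exact hv.1)
  obtain ⟨v, hv⟩ := sat homega (Set.range fun n => (s n).1) (by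
    intro F hF
    have : ∀ ψ : F, ∃ n, (s n).1 = ψ.1 := fun ψ => hF ψ.2
    choose g hg using this
    obtain ⟨v, hv⟩ := (s (Finset.univ.sup g)).2.1
    refine ⟨v, fun ψ hψ => ?_⟩
    have := (hle _ _).1 (hs (Finset.le_sup (f := g) (Finset.mem_univ ⟨ψ, hψ⟩))) v hv
    rwa [hg] at this)
  obtain ⟨n, hn⟩ := hs' v
  exact hn (hv _ ⟨n, rfl⟩)

theorem Iso.extend [Countable L.Symbols] [Infinite M] [Countable M] (homega : OmegaCategorical L M)
    {α : Type} [Finite α] {u : α → M} (hu : Iso L u) (φ : L.Formula (Option α))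
    (v : Option α → M) (hv : v ∘ some = u) (hφ : φ.Realize v) :
    ∃ v' : Option α → M, v' ∘ some = u ∧ φ.Realize v' ∧ Iso L v' := by
  obtain ⟨θ, h1, h2⟩ := hu
  obtain ⟨w, hw, χ, h3, h4⟩ := exists_iso homega (θ.relabel some ⊓ φ) ⟨v, by
    rw [Formula.realize_inf, Formula.realize_relabel, hv]
    exact ⟨h1, hφ⟩⟩
  rw [Formula.realize_inf, Formula.realize_relabel] at hw
  have hs := h2 _ hw.1
  have hd : (∅ : Set M).Definable L {v : Option α → M | χ.Realize v} :=
    Set.empty_definable_iff.2 ⟨χ, rfl⟩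
  obtain ⟨θ', h'⟩ := Set.empty_definable_iff.1 (hd.image_comp (some : α → Option α))
  have h5 : w ∘ some ∈ Set.ofPred θ'.Realize := by
    rw [← h']
    exact ⟨w, h3, rfl⟩
  have h6 : u ∈ Set.ofPred θ'.Realize := (hs θ').2 h5
  rw [← h'] at h6
  obtain ⟨v', h7, h8⟩ := h6
  have h9 := h4 v' h7
  exact ⟨v', h8, (h9 φ).1 hw.2, χ, h7, fun x hx φ => (h9 φ).symm.trans (h4 x hx φ)⟩

theorem Iso.finset {α : Type} [Finite α] {u : α → M} (hu : Iso L u) (s : Finset M)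
    (hs : ∀ x ∈ s, ∃ i, u i = x) : Iso L (fun x : s => x.1) := by
  choose g hg using hs
  have := hu.comp (fun x : s => g x.1 x.2)
  convert this using 1
  funext x
  exact (hg _ _).symm

theorem atomic [Countable L.Symbols] [Infinite M] [Countable M]
    (hrel : ∀ i, IsEmpty (L.Functions i)) (homega : OmegaCategorical L M)
    {α : Type} [Finite α] (b : α → M) : Iso L b := by
  classical
  let P := {s : Finset M // Iso L (fun x : s => x.1)}
  let ι := Σ n, (L.BoundedFormula Empty (n+1) × (Fin n → M))
  haveI : ∀ n, Countable (L.BoundedFormula Empty n) := fun n =>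
    (Function.Injective.countable
      (f := fun φ => (⟨n, φ⟩ : Σ n, L.BoundedFormula Empty n))) <| sigma_mk_injective
  have h0 : Iso L (fun x : (∅ : Finset M) => x.1) := by
    obtain ⟨v, -, hv⟩ := exists_iso homega (⊤ : L.Formula (∅ : Finset M))
      ⟨fun x => x.1, by simp⟩
    convert hv using 1
    funext x
    exact (Finset.notMem_empty _ x.2).elim
  let D : ι → Set P := fun i => {s | (∃ b ∈ s.1, i.2.1.Realize default (Fin.snoc i.2.2 b : _ → M)) ∨
    (¬ ∃ b, i.2.1.Realize default (Fin.snoc i.2.2 b : _ → M)) ∨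
    ∀ t, s ≤ t → ¬ ∀ j, i.2.2 j ∈ t.1}
  obtain ⟨s, hs, -, hs'⟩ := exists_generic (P := P) ⟨∅, h0⟩ D (by
    rintro ⟨n, φ, x⟩ s
    by_cases h1 : ∃ a, φ.Realize default (Fin.snoc x a : _ → M)
    swap
    · exact ⟨s, Or.inr (Or.inl h1), le_rfl⟩
    by_cases h2 : ∃ t, s ≤ t ∧ ∀ j, x j ∈ t.1
    swap
    · push Not at h2
      refine ⟨s, Or.inr (Or.inr fun t ht hj => ?_), le_rfl⟩
      obtain ⟨j, hj'⟩ := h2 t ht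
      exact hj' (hj j)
    obtain ⟨a, ha⟩ := h1
    obtain ⟨t, hst, ht⟩ := h2
    let g : Fin (n+1) → Option t.1 := Fin.snoc (fun i => some ⟨x i, ht i⟩) none
    let φ' : L.Formula (Option t.1) := φ.toFormula.relabel (Sum.elim Empty.elim g)
    have key : ∀ v : Option t.1 → M, v ∘ some = (fun x : t.1 => x.1) →
        (φ'.Realize v ↔ φ.Realize default (Fin.snoc x (v none) : _ → M)) := by
      intro v hv
      simp only [φ', Formula.realize_relabel, BoundedFormula.realize_toFormula]
      have e1 : (v ∘ Sum.elim Empty.elim g) ∘ Sum.inl = default := Subsingleton.elim _ _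
      have e2 : (v ∘ Sum.elim Empty.elim g) ∘ Sum.inr = (Fin.snoc x (v none) : _ → M) := by
        funext i
        refine Fin.lastCases ?_ (fun i => ?_) i
        · simp [g]
        · simpa [g] using congrFun hv ⟨x i, ht i⟩
      rw [e1, e2]
    obtain ⟨v', h3, h4, h5⟩ := t.2.extend homega φ' (fun o => o.elim a (fun x => x.1)) rfl
      ((key _ rfl).2 ha)
    refine ⟨⟨insert (v' none) t.1, h5.finset _ ?_⟩, ?_, ?_⟩
    · intro y hy
      rcases Finset.mem_insert.1 hy with rfl | hy
      · exact ⟨none, rfl⟩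
      · exact ⟨some ⟨y, hy⟩, congrFun h3 ⟨y, hy⟩⟩
    · exact Or.inl ⟨v' none, Finset.mem_insert_self _ _, (key _ h3).1 h4⟩
    · exact hst.trans (Finset.subset_insert _ _))
  have hfin : ∀ {β : Type} [Finite β] (c : β → M), (∀ i, ∃ n, c i ∈ (s n).1) →
      ∃ n, ∀ i, c i ∈ (s n).1 := by
    intro β _ c hc
    haveI := Fintype.ofFinite β
    choose g hg using hc
    exact ⟨Finset.univ.sup g, fun i => hs (Finset.le_sup (f := g) (Finset.mem_univ i)) (hg i)⟩
  let N : L.Substructure M :=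
    { carrier := {x | ∃ n, x ∈ (s n).1}
      fun_mem := fun {n} f => ((hrel n).false f).elim }
  have hN : N.IsElementary := by
    apply Substructure.isElementary_of_exists
    intro n φ x a ha
    obtain ⟨k, hk⟩ := hs' ⟨n, φ, (↑) ∘ x⟩
    rcases hk with ⟨b, hb, hb'⟩ | h | h
    · exact ⟨⟨b, k, hb⟩, hb'⟩
    · exact (h ⟨a, ha⟩).elim
    · obtain ⟨l, hl⟩ := hfin (fun i => (x i : M)) (fun i => (x i).2)
      exact (h (s (max k l)) (hs (le_max_left _ _))
        (fun j => hs (le_max_right k l) (hl j))).elim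
  let N' : L.ElementarySubstructure M := ⟨N, hN⟩
  haveI : Countable N' := Subtype.countable
  obtain ⟨e⟩ := homega N' inferInstance (fun φ hφ => (N'.realize_sentence φ).2 hφ)
  let j : M ↪ₑ[L] M := N'.subtype.comp e.toElementaryEmbedding
  obtain ⟨n, hn⟩ := hfin (j ∘ b) (fun i => (e (b i)).2)
  have h1 : Iso L (j ∘ b) := (s n).2.comp (fun i => ⟨j (b i), hn i⟩)
  obtain ⟨θ, h2, h3⟩ := h1
  refine ⟨θ, (j.map_formula θ b).1 h2, fun v hv φ => ?_⟩
  rw [← j.map_formula φ b, ← j.map_formula φ v]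
  exact h3 _ ((j.map_formula θ v).2 hv) φ

theorem reps [Countable L.Symbols] [Infinite M] [Countable M]
    (hrel : ∀ i, IsEmpty (L.Functions i)) (homega : OmegaCategorical L M)
    (α : Type) [Finite α] :
    ∃ F : Finset (α → M), ∀ v, ∃ u ∈ F, Same L u v := by
  classical
  by_contra hcon
  push Not at hcon
  have hat := fun b : α → M => atomic hrel homega b
  choose θ h1 h2 using hat
  obtain ⟨v, hv⟩ := sat homega (Set.range fun u => (θ u).not) (by
    intro F hF
    have : ∀ ψ : F, ∃ u, (θ u).not = ψ.1 := fun ψ => hF ψ.2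
    choose g hg using this
    obtain ⟨v, hv⟩ := hcon (Finset.univ.image g)
    refine ⟨v, fun ψ hψ => ?_⟩
    have e : _ = ψ := hg ⟨ψ, hψ⟩
    rw [← e, Formula.realize_not]
    exact fun h => hv _ (Finset.mem_image_of_mem _ (Finset.mem_univ _)) (h2 _ _ h))
  exact Formula.realize_not.1 (hv _ ⟨v, rfl⟩) (h1 v)

/-- Existentially definable predicates. -/
def Ex (L : Language) {M : Type} [L.Structure M] {α : Type} (p : (α → M) → Prop) : Prop :=
  ∃ (β : Type) (_ : Finite β) (ψ : L.Formula (α ⊕ β)), ψ.IsQF ∧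
    ∀ v, p v ↔ ∃ w, ψ.Realize (Sum.elim v w)

theorem isExistential_exs {α : Type} : ∀ {n : ℕ} {φ : L.BoundedFormula α n},
    IsExistential φ → IsExistential φ.exs
  | 0, _, h => h
  | n + 1, φ, h => isExistential_exs (n := n) (φ := φ.ex) h.ex

theorem Ex.formula {α : Type} {p : (α → M) → Prop} (h : Ex L p) :
    ∃ φ : L.Formula α, IsExistential φ ∧ ∀ v, p v ↔ φ.Realize v := by
  obtain ⟨β, _, ψ, hq, hp⟩ := h
  refine ⟨ψ.iExs β, ?_, fun v => (hp v).trans Formula.realize_iExs.symm⟩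
  exact isExistential_exs (.of_isQF (hq.relabel _))

theorem Ex.same {α : Type} {p : (α → M) → Prop} (h : Ex L p) {u v : α → M} (huv : Same L u v) :
    p u ↔ p v := by
  obtain ⟨φ, -, hφ⟩ := h.formula
  rw [hφ, hφ]
  exact huv φ

theorem Ex.of_isQF {α : Type} (ψ : L.Formula α) (h : ψ.IsQF) :
    Ex L (fun v : α → M => ψ.Realize v) := by
  refine ⟨Empty, inferInstance, ψ.relabel Sum.inl, h.relabel _, fun v => ?_⟩
  simp only [Formula.realize_relabel, Sum.elim_comp_inl]
  exact ⟨fun h => ⟨Empty.elim, h⟩, fun ⟨_, h⟩ => h⟩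

theorem Ex.comp {α γ : Type} {p : (α → M) → Prop} (h : Ex L p) (g : α → γ) :
    Ex L (fun v : γ → M => p (v ∘ g)) := by
  obtain ⟨β, _, ψ, hq, hp⟩ := h
  refine ⟨β, inferInstance, ψ.relabel (Sum.map g id), hq.relabel _, fun v => ?_⟩
  simp only [hp]
  simp only [Formula.realize_relabel, Sum.elim_comp_map, Function.comp_id]

theorem Ex.and {α : Type} {p q : (α → M) → Prop} (hp : Ex L p) (hq : Ex L q) :
    Ex L (fun v => p v ∧ q v) := by
  obtain ⟨β, _, ψ, h1, hp⟩ := hp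
  obtain ⟨β', _, ψ', h1', hq⟩ := hq
  refine ⟨β ⊕ β', inferInstance, ψ.relabel (Sum.map id Sum.inl) ⊓ ψ'.relabel (Sum.map id Sum.inr),
    (h1.relabel _).inf (h1'.relabel _), fun v => ?_⟩
  simp only [hp, hq]
  simp only [Formula.realize_inf, Formula.realize_relabel, Sum.elim_comp_map, Function.comp_id]
  constructor
  · rintro ⟨⟨w, hw⟩, w', hw'⟩
    exact ⟨Sum.elim w w', by simpa using hw, by simpa using hw'⟩
  · rintro ⟨w, h, h'⟩
    exact ⟨⟨_, h⟩, _, h'⟩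

theorem Ex.or [Nonempty M] {α : Type} {p q : (α → M) → Prop} (hp : Ex L p) (hq : Ex L q) :
    Ex L (fun v => p v ∨ q v) := by
  obtain ⟨β, _, ψ, h1, hp⟩ := hp
  obtain ⟨β', _, ψ', h1', hq⟩ := hq
  refine ⟨β ⊕ β', inferInstance, ψ.relabel (Sum.map id Sum.inl) ⊔ ψ'.relabel (Sum.map id Sum.inr),
    (h1.relabel _).sup (h1'.relabel _), fun v => ?_⟩
  simp only [hp, hq]
  simp only [Formula.realize_sup, Formula.realize_relabel, Sum.elim_comp_map, Function.comp_id]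
  constructor
  · rintro (⟨w, hw⟩ | ⟨w', hw'⟩)
    · exact ⟨Sum.elim w (fun _ => Classical.arbitrary M), Or.inl (by simpa using hw)⟩
    · exact ⟨Sum.elim (fun _ => Classical.arbitrary M) w', Or.inr (by simpa using hw')⟩
  · rintro ⟨w, h | h'⟩
    · exact Or.inl ⟨_, h⟩
    · exact Or.inr ⟨_, h'⟩

theorem Ex.ex {α : Type} {p : (Option α → M) → Prop} (hp : Ex L p) :
    Ex L (fun v : α → M => ∃ v', v' ∘ some = v ∧ p v') := by
  obtain ⟨β, _, ψ, h1, hp⟩ := hp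
  refine ⟨Option β, inferInstance, ψ.relabel
    (Sum.elim (fun o => o.elim (Sum.inr none) Sum.inl) (fun b => Sum.inr (some b))),
    h1.relabel _, fun v => ?_⟩
  simp only [hp, Formula.realize_relabel]
  have key : ∀ (v : Option α → M) (w : Option β → M), v none = w none →
      Sum.elim (v ∘ some) w ∘
        (Sum.elim (fun o => o.elim (Sum.inr none) Sum.inl) (fun b => Sum.inr (some b))) =
      Sum.elim v (w ∘ some) := by
    intro v w hvw
    funext x
    rcases x with (_ | x) | x <;> simp [hvw]
  constructor
  · rintro ⟨v', rfl, w, hw⟩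
    refine ⟨fun o => o.elim (v' none) w, ?_⟩
    rw [key]
    · exact hw
    · rfl
  · rintro ⟨w, hw⟩
    refine ⟨fun o => o.elim (w none) v, rfl, w ∘ some, ?_⟩
    rw [← key]
    · exact hw
    · rfl

theorem Ex.ball {ι α : Type} {p : ι → (α → M) → Prop} (s : Finset ι) (hp : ∀ i ∈ s, Ex L (p i)) :
    Ex L (fun v => ∀ i ∈ s, p i v) := by
  classical
  induction s using Finset.induction_on with
  | empty => simpa using Ex.of_isQF (L := L) (M := M) (⊤ : L.Formula α) BoundedFormula.IsQF.top
  | insert a s ha ih =>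
    have := (hp a (Finset.mem_insert_self _ _)).and
      (ih fun i hi => hp i (Finset.mem_insert_of_mem hi))
    simpa using this

theorem Ex.bex [Nonempty M] {ι α : Type} {p : ι → (α → M) → Prop} (s : Finset ι)
    (hp : ∀ i ∈ s, Ex L (p i)) : Ex L (fun v => ∃ i ∈ s, p i v) := by
  classical
  induction s using Finset.induction_on with
  | empty => simpa using Ex.of_isQF (L := L) (M := M) (⊥ : L.Formula α) BoundedFormula.IsQF.falsum
  | insert a s ha ih =>
    have := (hp a (Finset.mem_insert_self _ _)).or
      (ih fun i hi => hp i (Finset.mem_insert_of_mem hi))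
    simpa using this

/-- Inclusion of existential types. -/
def ExLe (L : Language) {M : Type} [L.Structure M] {α : Type} (u v : α → M) : Prop :=
  ∀ p : (α → M) → Prop, Ex L p → p u → p v

theorem ExLe.comp {α β : Type} {u v : α → M} (h : ExLe L u v) (g : β → α) :
    ExLe L (u ∘ g) (v ∘ g) := fun _ hp hu => h _ (hp.comp g) hu

theorem ExLe.finset {α : Type} {u v : α → M} (h : ExLe L u v) (s : Finset (M × M))
    (hs : ∀ x ∈ s, ∃ i, (u i, v i) = x) :
    ExLe L (fun x : s => x.1.1) (fun x : s => x.1.2) := by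
  choose g hg using hs
  have := h.comp (fun x : s => g x.1 x.2)
  convert this using 1
  · funext x
    exact (congrArg Prod.fst (hg _ x.2)).symm
  · funext x
    exact (congrArg Prod.snd (hg _ x.2)).symm

theorem ExLe.extend [Countable L.Symbols] [Infinite M] [Countable M]
    (hrel : ∀ i, IsEmpty (L.Functions i)) (homega : OmegaCategorical L M)
    {α : Type} [Finite α] {u v : α → M} (h : ExLe L u v) (u' : Option α → M) (hu' : u' ∘ some = u) :
    ∃ v' : Option α → M, v' ∘ some = v ∧ ExLe L u' v' := by
  classical
  by_contra hcon
  push Not at hcon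
  obtain ⟨F, hF⟩ := reps hrel homega (Option α)
  have h1 : ∀ w : Option α → M, ∃ p : (Option α → M) → Prop, Ex L p ∧ p u' ∧
      (¬ ExLe L u' w → ¬ p w) := by
    intro w
    by_cases hw : ExLe L u' w
    · refine ⟨fun _ => True, ?_, trivial, fun h => (h hw).elim⟩
      simpa using Ex.of_isQF (L := L) (M := M) (⊤ : L.Formula (Option α)) BoundedFormula.IsQF.top
    · unfold ExLe at hw
      push Not at hw
      obtain ⟨p, h1, h2, h3⟩ := hw
      exact ⟨p, h1, h2, fun _ => h3⟩
  choose p hp hpu hpw using h1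
  have h2 := (Ex.ball F (fun w _ => hp w)).ex
  obtain ⟨v', hv, hv'⟩ := h _ h2 ⟨u', hu', fun w _ => hpu w⟩
  obtain ⟨w, hw, hs⟩ := hF v'
  refine hpw w ?_ (((hp w).same hs).2 (hv' w hw))
  intro hle
  exact hcon v' hv fun q hq hqu => (hq.same hs).1 (hle q hq hqu)

theorem exists_selfEmb [Countable L.Symbols] [Infinite M] [Countable M]
    (hrel : ∀ i, IsEmpty (L.Functions i)) (homega : OmegaCategorical L M)
    {α : Type} [Finite α] {u v : α → M} (h : ExLe L u v) :
    ∃ f : M → M, IsSelfEmb L M f ∧ ∀ i, f (u i) = v i := by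
  classical
  haveI := Fintype.ofFinite α
  let P := {s : Finset (M × M) // ExLe L (fun x : s => x.1.1) (fun x : s => x.1.2)}
  obtain ⟨s, hs, hs0, hs'⟩ := exists_generic (P := P)
    ⟨Finset.univ.image (fun i => (u i, v i)), h.finset _ (by simp)⟩
    (fun c : M => {s | ∃ d, (c, d) ∈ s.1}) (by
      intro c t
      obtain ⟨v', h1, h2⟩ := t.2.extend hrel homega
        (fun o => o.elim c (fun x => x.1.1)) rfl
      refine ⟨⟨insert (c, v' none) t.1, h2.finset _ ?_⟩, ⟨v' none, Finset.mem_insert_self _ _⟩,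
        Finset.subset_insert _ _⟩
      intro y hy
      rcases Finset.mem_insert.1 hy with rfl | hy
      · exact ⟨none, rfl⟩
      · exact ⟨some ⟨y, hy⟩, Prod.ext rfl (congrFun h1 ⟨y, hy⟩)⟩)
  have hall : ∀ c, ∃ d n, (c, d) ∈ (s n).1 := fun c => by
    obtain ⟨n, d, h⟩ := hs' c
    exact ⟨d, n, h⟩
  -- any finite family of pairs satisfies `ExLe`
  have hfin : ∀ {β : Type} [Finite β] (c d : β → M), (∀ i, ∃ n, (c i, d i) ∈ (s n).1) →
      ExLe L c d := by
    intro β _ c d hc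
    haveI := Fintype.ofFinite β
    choose g hg using hc
    have hn : ∀ i, (c i, d i) ∈ (s (Finset.univ.sup g)).1 :=
      fun i => hs (Finset.le_sup (f := g) (Finset.mem_univ i)) (hg i)
    exact (s (Finset.univ.sup g)).2.comp (fun i => ⟨_, hn i⟩)
  have hqf : ∀ {β : Type} [Finite β] (c d : β → M), (∀ i, ∃ n, (c i, d i) ∈ (s n).1) →
      ∀ ψ : L.Formula β, ψ.IsQF → (ψ.Realize d ↔ ψ.Realize c) := by
    intro β _ c d hc ψ hψ
    refine ⟨fun h1 => ?_, fun h1 => hfin c d hc _ (Ex.of_isQF ψ hψ) h1⟩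
    by_contra h2
    exact Formula.realize_not.1 (hfin c d hc _ (Ex.of_isQF ψ.not hψ.not)
      (Formula.realize_not.2 h2)) h1
  have heq : ∀ {c d c' d' : M}, (∃ n, (c, d) ∈ (s n).1) → (∃ n, (c', d') ∈ (s n).1) →
      (d = d' ↔ c = c') := by
    intro c d c' d' h1 h2
    have := hqf ![c, c'] ![d, d'] (by
      intro i
      fin_cases i
      · exact h1
      · exact h2) (Term.equal (Term.var 0) (Term.var 1))
      (BoundedFormula.IsAtomic.equal _ _).isQF
    simpa [Formula.realize_equal] using this
  choose f hf using hall
  refine ⟨f, ⟨fun c c' hc => (heq (hf c) (hf c')).1 hc, fun n r x => ?_⟩, fun i => ?_⟩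
  · have := hqf x (fun i => f (x i)) (fun i => hf (x i)) (r.formula (fun i => Term.var i))
      (BoundedFormula.IsAtomic.rel _ _).isQF
    simpa [Formula.realize_rel] using this
  · refine (heq (hf (u i)) ⟨0, ?_⟩).2 rfl
    rw [← hs0]
    exact Finset.mem_image_of_mem (fun i => (u i, v i)) (Finset.mem_univ i)

theorem IsExistential.realize_selfEmb (hrel : ∀ i, IsEmpty (L.Functions i)) {α : Type} {n : ℕ}
    {φ : L.BoundedFormula α n} (hφ : IsExistential φ) {f : M → M} (hf : IsSelfEmb L M f)
    {v : α → M} {xs : Fin n → M} (h : φ.Realize v xs) : φ.Realize (f ∘ v) (f ∘ xs) := by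
  let e : M ↪[L] M :=
    { toFun := f
      inj' := hf.1
      map_fun' := fun {n} g => ((hrel n).false g).elim
      map_rel' := fun r x => hf.2 _ r x }
  induction hφ with
  | of_isQF hq => exact (hq.realize_embedding e).2 h
  | ex _ ih =>
    rw [BoundedFormula.realize_ex] at h ⊢
    obtain ⟨a, ha⟩ := h
    refine ⟨f a, ?_⟩
    rw [← Fin.comp_snoc]
    exact ih ha

end aux

/-- **Theorem 3 (2).**  Over a countably infinite ω-categorical structure with countable
relational signature, a relation is existentially definable if and only if it is preserved by
all self-embeddings. -/
theorem ex_definable_iff_preserved_by_self_embeddings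
    (L : Language) (M : Type) [L.Structure M] [Countable M] [Infinite M]
    (hrel : ∀ i, IsEmpty (L.Functions i)) (hcnt : Countable (Σ i, L.Relations i))
    (homega : OmegaCategorical L M) (m : ℕ) (R : (Fin m → M) → Prop) :
    (∃ φ : L.Formula (Fin m), IsExistential φ ∧ ∀ x, R x ↔ φ.Realize x) ↔
      ∀ f : M → M, IsSelfEmb L M f → Preserves1 f R := by
  haveI : Countable (Σ i, L.Functions i) :=
    have : IsEmpty (Σ i, L.Functions i) := ⟨fun x => (hrel x.1).false x.2⟩
    inferInstance
  haveI : Countable L.Symbols := inferInstanceAs (Countable (_ ⊕ _))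
  classical
  constructor
  · rintro ⟨φ, hφ, hR⟩ f hf a ha
    rw [hR] at ha ⊢
    have := hφ.realize_selfEmb hrel hf ha
    rwa [Subsingleton.elim (f ∘ default) default] at this
  · intro hpres
    have hle : ∀ a b : Fin m → M, ExLe L a b → R a → R b := by
      intro a b hab ha
      obtain ⟨f, hf, hfa⟩ := exists_selfEmb hrel homega hab
      have := hpres f hf a ha
      rwa [show (fun i => f (a i)) = b from funext hfa] at this
    have hsame : ∀ a b : Fin m → M, Same L a b → (R a ↔ R b) := fun a b hab =>
      ⟨hle a b fun p hp => (hp.same hab).1, hle b a fun p hp => (hp.same hab).2⟩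
    obtain ⟨F, hF⟩ := reps hrel homega (Fin m)
    have hsep : ∀ a b : Fin m → M, ∃ p : (Fin m → M) → Prop,
        R a → ¬ R b → Ex L p ∧ p a ∧ ¬ p b := by
      intro a b
      by_cases hab : ExLe L a b
      · exact ⟨fun _ => True, fun h h' => (h' (hle a b hab h)).elim⟩
      · unfold ExLe at hab
        push Not at hab
        obtain ⟨p, h⟩ := hab
        exact ⟨p, fun _ _ => h⟩
    choose p hp using hsep
    have hex : Ex L (fun v => ∃ a ∈ F.filter R, ∀ b ∈ F.filter (fun b => ¬ R b), p a b v) :=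
      Ex.bex _ fun a ha => Ex.ball _ fun b hb =>
        (hp a b (Finset.mem_filter.1 ha).2 (Finset.mem_filter.1 hb).2).1
    obtain ⟨φ, hφ, hφ'⟩ := hex.formula
    refine ⟨φ, hφ, fun x => Iff.trans ?_ (hφ' x)⟩
    obtain ⟨y, hy, hyx⟩ := hF x
    rw [← hsame y x hyx]
    rw [← hex.same hyx]
    constructor
    · intro hRy
      exact ⟨y, Finset.mem_filter.2 ⟨hy, hRy⟩, fun b hb =>
        (hp y b hRy (Finset.mem_filter.1 hb).2).2.1⟩
    · rintro ⟨a, ha, h⟩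
      by_contra hRy
      exact (hp a y (Finset.mem_filter.1 ha).2 hRy).2.2 (h y (Finset.mem_filter.2 ⟨hy, hRy⟩))

end PaperDef
end
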